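/- arXiv:2005.01080 — 2 statements merged into one kernel-verified Lean document; each statement's English description precedes it below -/
import Mathlib

section
/- Let n, k, r, s be positive integers with r ≤ s ≤ k + r − 1, and let H be an r-graph on n vertices with matching number ν(H) ≤ k. If n ≥ 4(e·r)^{s−r+2}·k (where e is Euler's number), then the number of s-cliques of H satisfies K_s^r(H) ≤ K_s^r(F^{(r)}_{n,k,1}). -/
open Finset

/-- The number of `s`-cliques of the `r`-uniform hypergraph `H`
(sets of `s` vertices all of whose `r`-element subsets are edges). -/
def cliqueCount {V : Type*} [Fintype V] [DecidableEq V] (r s : ℕ)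
    (H : Finset (Finset V)) : ℕ :=
  ((Finset.univ.powersetCard s).filter (fun S => S.powersetCard r ⊆ H)).card

/-- The hypergraph `F^{(r)}_{n,k,a}` on `Fin n`: all `r`-element subsets having
at least `a` elements among the first `a*k + a - 1` vertices. -/
def Fnka (n k r a : ℕ) : Finset (Finset (Fin n)) :=
  (Finset.univ.powersetCard r).filter
    (fun E => a ≤ (E.filter (fun x : Fin n => (x : ℕ) < a * k + a - 1)).card)

/-- The matching number of `H` is at most `k`. -/
def matchingLE {V : Type*} (H : Finset (Finset V)) (k : ℕ) : Prop :=
  ∀ M ⊆ H, (M : Set (Finset V)).Pairwise Disjoint → M.card ≤ k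

/-- The degree of a vertex set `A`: the number of edges of `H` containing `A`. -/
def degOf {V : Type*} [DecidableEq V] (H : Finset (Finset V)) (A : Finset V) : ℕ :=
  (H.filter (fun E => A ⊆ E)).card

/-- The shifting operator `S_{ij}` applied to a single edge. -/
def shiftEdge {n : ℕ} (H : Finset (Finset (Fin n))) (i j : Fin n)
    (E : Finset (Fin n)) : Finset (Fin n) :=
  if j ∈ E ∧ i ∉ E ∧ insert i (E.erase j) ∉ H then insert i (E.erase j) else E

/-- The shifted hypergraph `S_{ij}(H)`. -/
def shift {n : ℕ} (H : Finset (Finset (Fin n))) (i j : Fin n) :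
    Finset (Finset (Fin n)) :=
  H.image (shiftEdge H i j)

/-- `H` is stable if it is invariant under all shifts `S_{ij}` with `i < j`. -/
def IsStable {n : ℕ} (H : Finset (Finset (Fin n))) : Prop :=
  ∀ i j : Fin n, i < j → shift H i j = H

/-- The `s`-cliques of a hypergraph `H` on the vertex set `{0, …, n - 1}`. -/
def natCliques (n r s : ℕ) (H : Finset (Finset ℕ)) : Finset (Finset ℕ) :=
  ((range n).powersetCard s).filter (fun S => S.powersetCard r ⊆ H)

/-- Closure under replacing a vertex of an edge by a smaller vertex. -/
def IsShifted (H : Finset (Finset ℕ)) : Prop :=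
  ∀ E ∈ H, ∀ i j, i < j → j ∈ E → i ∉ E → insert i (E.erase j) ∈ H

lemma mem_natCliques {n r s : ℕ} {H : Finset (Finset ℕ)} {S : Finset ℕ} :
    S ∈ natCliques n r s H ↔
      S ⊆ range n ∧ S.card = s ∧ ∀ E ⊆ S, E.card = r → E ∈ H := by
  simp only [natCliques, mem_filter, mem_powersetCard, subset_iff (s₁ := powersetCard r S)]
  grind

lemma mem_compression_singleton {H : Finset (Finset ℕ)} {i j : ℕ} (hij : i ≠ j) {E : Finset ℕ} :
    E ∈ UV.compression {i} {j} H ↔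
      (E ∈ H ∧ (j ∈ E → i ∉ E → insert i (E.erase j) ∈ H)) ∨
      (E ∉ H ∧ i ∈ E ∧ j ∉ E ∧ insert j (E.erase i) ∈ H) := by
  have key : ∀ B : Finset ℕ, UV.compress {i} {j} B =
      if j ∈ B ∧ i ∉ B then insert i (B.erase j) else B := by
    intro B
    unfold UV.compress
    have : (Disjoint {i} B ∧ ({j} : Finset ℕ) ≤ B) ↔ (j ∈ B ∧ i ∉ B) := by
      simp [and_comm]
    simp only [this]
    split_ifs
    · ext x
      simp only [sup_eq_union, mem_sdiff, mem_union, mem_singleton, mem_insert, mem_erase]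
      grind
    · rfl
  rw [UV.mem_compression]
  simp only [key]
  constructor
  · rintro (⟨h1, h2⟩ | ⟨h1, B, hB, h2⟩)
    · left
      refine ⟨h1, fun a b => ?_⟩
      rwa [if_pos ⟨a, b⟩] at h2
    · right
      split_ifs at h2 with h
      · subst h2
        refine ⟨h1, by simp, by simp [hij.symm], ?_⟩
        convert hB using 1
        ext x
        simp only [mem_insert, mem_erase]
        grind
      · exact absurd (h2 ▸ hB) h1
  · rintro (⟨h1, h2⟩ | ⟨h1, h2, h3, h4⟩)
    · left
      refine ⟨h1, ?_⟩
      split_ifs with h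
      · exact h2 h.1 h.2
      · exact h1
    · right
      refine ⟨h1, _, h4, ?_⟩
      rw [if_pos (by simp [hij])]
      ext x
      simp only [mem_insert, mem_erase]
      grind

lemma card_replace {E : Finset ℕ} {i j : ℕ} (hj : j ∈ E) (hi : i ∉ E) :
    (insert i (E.erase j)).card = E.card := by
  rw [card_insert_of_notMem (by simp [hi]), card_erase_add_one hj]

lemma replace_replace {E : Finset ℕ} {i j : ℕ} (hj : j ∈ E) (hi : i ∉ E) :
    insert j ((insert i (E.erase j)).erase i) = E := by
  ext x
  simp only [mem_insert, mem_erase]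
  grind

lemma compression_natCliques_subset {n r s i j : ℕ} (hij : i < j) (hj : j < n)
    {H : Finset (Finset ℕ)} :
    UV.compression {i} {j} (natCliques n r s H) ⊆
      natCliques n r s (UV.compression {i} {j} H) := by
  intro S hS
  rw [mem_compression_singleton hij.ne] at hS
  rw [mem_natCliques]
  rcases hS with ⟨hS, hS'⟩ | ⟨hS, hi, hj', hS'⟩
  · rw [mem_natCliques] at hS
    refine ⟨hS.1, hS.2.1, fun E hE hEr => ?_⟩
    rw [mem_compression_singleton hij.ne]
    refine Or.inl ⟨hS.2.2 E hE hEr, fun h1 h2 => ?_⟩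
    by_cases hiS : i ∈ S
    · refine hS.2.2 _ ?_ (by rw [card_replace h1 h2, hEr])
      intro x hx
      simp only [mem_insert, mem_erase] at hx
      rcases hx with rfl | hx
      · exact hiS
      · exact hE hx.2
    · have := hS' (hE h1) hiS
      rw [mem_natCliques] at this
      refine this.2.2 _ ?_ (by rw [card_replace h1 h2, hEr])
      exact insert_subset_insert _ (erase_subset_erase _ hE)
  · rw [mem_natCliques] at hS'
    obtain ⟨h1, h2, h3⟩ := hS'
    refine ⟨?_, ?_, fun E hE hEr => ?_⟩
    · intro x hx
      by_cases hxi : x = i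
      · rw [mem_range]; omega
      · exact h1 (by simp [hxi, hx])
    · rw [← h2, card_replace hi hj']
    · rw [mem_compression_singleton hij.ne]
      have hjE : j ∉ E := fun h => hj' (hE h)
      by_cases hiE : i ∈ E
      · have h4 : insert j (E.erase i) ∈ H := by
          refine h3 _ (insert_subset_insert _ (erase_subset_erase _ hE)) ?_
          rw [card_replace hiE hjE, hEr]
        by_cases hEH : E ∈ H
        · exact Or.inl ⟨hEH, fun h => absurd h hjE⟩
        · exact Or.inr ⟨hEH, hiE, hjE, h4⟩
      · refine Or.inl ⟨h3 E ?_ hEr, fun h => absurd h hjE⟩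
        intro x hx
        have : x ≠ i := by rintro rfl; exact hiE hx
        simp [this, hE hx]

lemma card_natCliques_le_compression {n r s i j : ℕ} (hij : i < j) (hj : j < n)
    (H : Finset (Finset ℕ)) :
    (natCliques n r s H).card ≤ (natCliques n r s (UV.compression {i} {j} H)).card := by
  rw [← UV.card_compression {i} {j} (natCliques n r s H)]
  exact card_le_card (compression_natCliques_subset hij hj)

lemma matchingLE_compression {k i j : ℕ} (hij : i < j) {H : Finset (Finset ℕ)}
    (hH : matchingLE H k) : matchingLE (UV.compression {i} {j} H) k := by
  intro M hM hdisj
  by_cases hMH : M ⊆ H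
  · exact hH M hMH hdisj
  obtain ⟨F, hFM, hFH⟩ := not_subset.1 hMH
  have hF := (mem_compression_singleton hij.ne).1 (hM hFM)
  simp only [hFH, false_and, not_false_eq_true, true_and, false_or] at hF
  let σ : ℕ ↪ ℕ := (Equiv.swap i j).toEmbedding
  have hσ : ∀ G ∈ M, G.map σ ∈ H := by
    intro G hG
    by_cases hGF : G = F
    · subst hGF
      convert hF.2.2 using 1
      ext x
      simp only [mem_map, σ, Equiv.coe_toEmbedding, mem_insert, mem_erase]
      constructor
      · rintro ⟨y, hy, rfl⟩
        rw [Equiv.swap_apply_def]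
        grind
      · intro h
        refine ⟨Equiv.swap i j x, ?_, by simp⟩
        rw [Equiv.swap_apply_def]
        grind
    · have hd := hdisj hG hFM hGF
      have hiG : i ∉ G := fun h => (disjoint_left.1 hd h) hF.1
      have hG' := (mem_compression_singleton hij.ne).1 (hM hG)
      have hG1 : G ∈ H ∧ (j ∈ G → i ∉ G → insert i (G.erase j) ∈ H) := by
        rcases hG' with h | h
        · exact h
        · exact absurd h.2.1 hiG
      by_cases hjG : j ∈ G
      · convert hG1.2 hjG hiG using 1
        ext x
        simp only [mem_map, σ, Equiv.coe_toEmbedding, mem_insert, mem_erase]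
        constructor
        · rintro ⟨y, hy, rfl⟩
          rw [Equiv.swap_apply_def]
          grind
        · intro h
          refine ⟨Equiv.swap i j x, ?_, by simp⟩
          rw [Equiv.swap_apply_def]
          grind
      · convert hG1.1 using 1
        ext x
        simp only [mem_map, σ, Equiv.coe_toEmbedding]
        constructor
        · rintro ⟨y, hy, rfl⟩
          rw [Equiv.swap_apply_def]
          grind
        · intro h
          refine ⟨x, h, ?_⟩
          rw [Equiv.swap_apply_def]
          grind
  have := hH (M.map (mapEmbedding σ).toEmbedding) ?_ ?_
  · simpa using this
  · intro G hG
    obtain ⟨G', hG', rfl⟩ := mem_map.1 hG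
    exact hσ G' hG'
  · intro A hA B hB hAB
    obtain ⟨A', hA', rfl⟩ := mem_map.1 (mem_coe.1 hA)
    obtain ⟨B', hB', rfl⟩ := mem_map.1 (mem_coe.1 hB)
    have : A' ≠ B' := by rintro rfl; exact hAB rfl
    exact (disjoint_map σ).2 (hdisj hA' hB' this)

/-- The total label sum of a hypergraph, which strictly drops under a nontrivial compression. -/
def labelSum (H : Finset (Finset ℕ)) : ℕ := ∑ E ∈ H, ∑ x ∈ E, x

lemma labelSum_compression_lt {i j : ℕ} (hij : i < j) {H : Finset (Finset ℕ)} {E : Finset ℕ}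
    (hE : E ∈ H) (hj : j ∈ E) (hi : i ∉ E) (hE' : insert i (E.erase j) ∉ H) :
    labelSum (UV.compression {i} {j} H) < labelSum H := by
  let f : Finset ℕ → Finset ℕ := fun B =>
    if j ∈ B ∧ i ∉ B ∧ insert i (B.erase j) ∉ H then insert i (B.erase j) else B
  have hsub : UV.compression {i} {j} H ⊆ H.image f := by
    intro B hB
    rw [mem_compression_singleton hij.ne] at hB
    rw [mem_image]
    rcases hB with ⟨h1, h2⟩ | ⟨h1, h2, h3, h4⟩
    · exact ⟨B, h1, if_neg (by tauto)⟩
    · refine ⟨_, h4, ?_⟩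
      have := replace_replace h2 h3
      simp only [f]
      rw [this, if_pos]
      exact ⟨by simp, by simp [hij.ne], h1⟩
  have hrep : ∀ B : Finset ℕ, j ∈ B → i ∉ B →
      ∑ x ∈ insert i (B.erase j), x < ∑ x ∈ B, x := by
    intro B h1 h2
    rw [sum_insert (by simp [h2]), ← add_sum_erase B (fun x => x) h1]
    simpa using hij
  calc labelSum (UV.compression {i} {j} H) ≤ ∑ B ∈ H.image f, ∑ x ∈ B, x :=
        sum_le_sum_of_subset hsub
    _ ≤ ∑ B ∈ H, ∑ x ∈ f B, x := sum_image_le_of_nonneg (fun _ _ => Nat.zero_le _)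
    _ < ∑ B ∈ H, ∑ x ∈ B, x := by
        refine sum_lt_sum (fun B _ => ?_) ⟨E, hE, ?_⟩
        · simp only [f]
          split_ifs with h
          · exact (hrep B h.1 h.2.1).le
          · exact le_rfl
        · simp only [f]
          rw [if_pos ⟨hj, hi, hE'⟩]
          exact hrep E hj hi

lemma exists_isShifted {n r k : ℕ} (s : ℕ) (H : Finset (Finset ℕ))
    (hH : H ⊆ (range n).powersetCard r) (hm : matchingLE H k) :
    ∃ G ⊆ (range n).powersetCard r, matchingLE G k ∧ IsShifted G ∧
      (natCliques n r s H).card ≤ (natCliques n r s G).card := by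
  induction hw : labelSum H using Nat.strong_induction_on generalizing H with
  | _ w ih =>
    by_cases hst : IsShifted H
    · exact ⟨H, hH, hm, hst, le_rfl⟩
    unfold IsShifted at hst
    push Not at hst
    obtain ⟨E, hE, i, j, hij, hj, hi, hE'⟩ := hst
    have hjn : j < n := mem_range.1 ((mem_powersetCard.1 (hH hE)).1 hj)
    have hsub : UV.compression {i} {j} H ⊆ (range n).powersetCard r := by
      intro B hB
      rw [mem_compression_singleton hij.ne] at hB
      rcases hB with ⟨h1, _⟩ | ⟨_, h2, h3, h4⟩
      · exact hH h1
      · have := mem_powersetCard.1 (hH h4)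
        rw [card_replace h2 h3] at this
        refine mem_powersetCard.2 ⟨fun x hx => ?_, this.2⟩
        by_cases hxi : x = i
        · rw [mem_range]; omega
        · exact this.1 (by simp [hxi, hx])
    obtain ⟨G, hG1, hG2, hG3, hG4⟩ := ih _ (hw ▸ labelSum_compression_lt hij hE hj hi hE')
      (UV.compression {i} {j} H) hsub (matchingLE_compression hij hm) rfl
    exact ⟨G, hG1, hG2, hG3, (card_natCliques_le_compression hij hjn H).trans hG4⟩

/-- A shifted family contains every set dominated by one of its members. -/
lemma IsShifted.mem_of_dominated {H : Finset (Finset ℕ)} (hH : IsShifted H) {B E : Finset ℕ}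
    (hE : E ∈ H) (hcard : B.card = E.card)
    (hle : ∀ x, (E.filter (· < x)).card ≤ (B.filter (· < x)).card) : B ∈ H := by
  induction hw : (E \ B).card using Nat.strong_induction_on generalizing E with
  | _ w ih =>
    by_cases hEB : (E \ B).Nonempty
    swap
    · rw [not_nonempty_iff_eq_empty, sdiff_eq_empty_iff_subset] at hEB
      rwa [← eq_of_subset_of_card_le hEB hcard.le]
    obtain ⟨j, hj, hjmin⟩ := (E \ B).exists_min_image id hEB
    simp only [id] at hjmin
    obtain ⟨hjE, hjB⟩ := mem_sdiff.1 hj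
    have hlow : ∀ x ∈ E, x < j → x ∈ B := by
      intro x hx hxj
      by_contra hxB
      exact absurd (hjmin x (mem_sdiff.2 ⟨hx, hxB⟩)) (by omega)
    have hi : ∃ i ∈ B, i ∉ E ∧ i < j := by
      by_contra! hcon
      have hss : B.filter (· < j + 1) ⊂ E.filter (· < j + 1) := by
        refine (ssubset_iff_of_subset ?_).2 ⟨j, by simp [hjE], by simp [hjB]⟩
        intro x hx
        rw [mem_filter] at hx ⊢
        refine ⟨?_, hx.2⟩
        by_contra hxE
        have := hcon x hx.1 hxE
        have : x = j := by omega
        exact hjB (this ▸ hx.1)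
      exact absurd (hle (j + 1)) (not_le.2 (card_lt_card hss))
    obtain ⟨i, hiB, hiE, hij⟩ := hi
    refine ih _ ?_ (hH E hE i j hij hjE hiE) (by rw [card_replace hjE hiE, hcard]) ?_ rfl
    · rw [← hw]
      refine card_lt_card ((ssubset_iff_of_subset ?_).2 ⟨j, hj, by simp [hij.ne']⟩)
      intro x hx
      simp only [mem_sdiff, mem_insert, mem_erase] at hx ⊢
      grind
    · intro y
      rcases le_or_gt y j with hy | hy
      · refine card_le_card fun x hx => ?_
        simp only [mem_filter, mem_insert, mem_erase] at hx ⊢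
        grind
      · refine le_trans (le_of_eq ?_) (hle y)
        have : (insert i (E.erase j)).filter (· < y) = insert i ((E.filter (· < y)).erase j) := by
          ext x
          simp only [mem_filter, mem_insert, mem_erase]
          grind
        rw [this, card_replace (by simp [hjE, hy]) (by simp [hiE])]

lemma matchingLE.le_of_pairwise_disjoint {H : Finset (Finset ℕ)} {k p : ℕ} (hH : matchingLE H k)
    (f : ℕ → Finset ℕ) (hf : ∀ i < p, f i ∈ H) (hne : ∀ i < p, (f i).Nonempty)
    (hd : ∀ i < p, ∀ i' < p, i < i' → Disjoint (f i) (f i')) : p ≤ k := by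
  have hd' : ∀ i < p, ∀ i' < p, i ≠ i' → Disjoint (f i) (f i') := by
    intro i hi i' hi' h
    rcases lt_or_gt_of_ne h with h | h
    · exact hd i hi i' hi' h
    · exact (hd i' hi' i hi h).symm
  have hinj : Set.InjOn f (range p) := by
    intro i hi i' hi' h
    by_contra hne'
    have hi := mem_range.1 (mem_coe.1 hi)
    have := hd' i hi i' (mem_range.1 (mem_coe.1 hi')) hne'
    rw [← h, disjoint_self_iff_empty] at this
    exact (hne i hi).ne_empty this
  have := hH ((range p).image f) ?_ ?_
  · rwa [card_image_of_injOn hinj, card_range] at this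
  · intro A hA
    obtain ⟨i, hi, rfl⟩ := mem_image.1 hA
    exact hf i (mem_range.1 hi)
  · intro A hA B hB hAB
    obtain ⟨i, hi, rfl⟩ := mem_image.1 (mem_coe.1 hA)
    obtain ⟨i', hi', rfl⟩ := mem_image.1 (mem_coe.1 hB)
    exact hd' i (mem_range.1 hi) i' (mem_range.1 hi') (fun h => hAB (h ▸ rfl))

/-- In a shifted family of matching number at most `k` in which the vertices `0, …, j - 1` lie in
disjoint edges otherwise far to the right, each edge has, for some `a`, at least `a` vertices below
`j + a (k - j + 1) - 1`. -/
lemma IsShifted.exists_le_card_filter {k r j : ℕ} {H : Finset (Finset ℕ)}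
    (hH : IsShifted H) (hunif : ∀ E ∈ H, E.card = r) (hm : matchingLE H k) (hr : 1 ≤ r)
    (hjk : j ≤ k) (A : ℕ → Finset ℕ) (hA : ∀ i < j, insert i (A i) ∈ H)
    (hAN : ∀ i < j, ∀ x ∈ A i, r * (k + 1) ≤ x)
    (hAd : ∀ i < j, ∀ i' < j, i < i' → Disjoint (A i) (A i'))
    {E : Finset ℕ} (hE : E ∈ H) :
    ∃ a, 1 ≤ a ∧ a ≤ r ∧ a ≤ (E.filter (· < j + a * (k - j + 1) - 1)).card := by
  by_contra! hcon
  set q := k - j + 1 with hq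
  have hN : j + r * q ≤ r * (k + 1) := by
    have : k + 1 = q + j := by omega
    rw [this]
    nlinarith
  have hjN : j < r * (k + 1) := by nlinarith
  let B : ℕ → Finset ℕ := fun i => (range r).image (fun a => j + a * q + i)
  have hinj : ∀ i, Function.Injective (fun a => j + a * q + i) := by
    intro i a b h
    simp only at h
    exact Nat.eq_of_mul_eq_mul_right (by omega : 0 < q) (by omega)
  have hBN : ∀ i < q, ∀ x ∈ B i, j ≤ x ∧ x < r * (k + 1) := by
    intro i hi x hx
    obtain ⟨a, ha, rfl⟩ := mem_image.1 hx
    have := mem_range.1 ha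
    have h2 : (a + 1) * q ≤ r * q := Nat.mul_le_mul_right _ this
    constructor
    · omega
    · rw [add_mul] at h2
      omega
  have hB : ∀ i < q, B i ∈ H := by
    intro i hi
    refine hH.mem_of_dominated hE ?_ ?_
    · rw [card_image_of_injective _ (hinj i), card_range, hunif E hE]
    · intro x
      set c := (E.filter (· < x)).card with hc
      have hcr : c ≤ r := by
        rw [← hunif E hE]
        exact card_filter_le _ _
      rcases Nat.eq_zero_or_pos c with h0 | h0
      · omega
      have hx : j + c * q ≤ x := by
        by_contra hlt
        have h1 := hcon c h0 hcr
        have h2 : (E.filter (· < x)).card ≤ (E.filter (· < j + c * q - 1)).card := by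
          refine card_le_card fun y hy => ?_
          rw [mem_filter] at hy ⊢
          exact ⟨hy.1, by omega⟩
        omega
      calc c = ((range c).image (fun a => j + a * q + i)).card := by
            rw [card_image_of_injective _ (hinj i), card_range]
        _ ≤ ((B i).filter (· < x)).card := by
            refine card_le_card fun y hy => ?_
            obtain ⟨a, ha, rfl⟩ := mem_image.1 hy
            have ha := mem_range.1 ha
            have h2 : (a + 1) * q ≤ c * q := Nat.mul_le_mul_right _ ha
            rw [add_mul] at h2
            exact mem_filter.2 ⟨mem_image.2 ⟨a, mem_range.2 (by omega), rfl⟩, by omega⟩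
  have hBd : ∀ i < q, ∀ i' < q, i < i' → Disjoint (B i) (B i') := by
    intro i hi i' hi' h
    rw [disjoint_left]
    intro x hx hx'
    obtain ⟨a, -, rfl⟩ := mem_image.1 hx
    obtain ⟨b, -, hb⟩ := mem_image.1 hx'
    have h1 : (b * q + i') % q = (a * q + i) % q := by congr 1; omega
    rw [Nat.mul_add_mod', Nat.mul_add_mod', Nat.mod_eq_of_lt hi, Nat.mod_eq_of_lt hi'] at h1
    omega
  have := hm.le_of_pairwise_disjoint (p := k + 1)
    (fun i => if i < j then insert i (A i) else B (i - j)) ?_ ?_ ?_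
  · omega
  · intro i hi
    split_ifs with h
    · exact hA i h
    · exact hB _ (by omega)
  · intro i hi
    split_ifs with h
    · exact insert_nonempty _ _
    · exact (nonempty_range_iff.2 (by omega)).image _
  · intro i hi i' hi' h
    split_ifs with h1 h2 h2
    · rw [disjoint_left]
      intro x hx hx'
      rw [mem_insert] at hx hx'
      rcases hx with rfl | hx <;> rcases hx' with hx' | hx'
      · omega
      · have := hAN _ h2 _ hx'; omega
      · have := hAN _ h1 _ hx; omega
      · exact disjoint_left.1 (hAd i h1 i' h2 h) hx hx'
    · rw [disjoint_left]
      intro x hx hx'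
      have := hBN _ (by omega) x hx'
      rw [mem_insert] at hx
      rcases hx with rfl | hx
      · omega
      · have := hAN _ h1 _ hx; omega
    · omega
    · exact hBd _ (by omega) _ (by omega) (by omega)

lemma IsShifted.insert_mem {H : Finset (Finset ℕ)} (hH : IsShifted H) {A : Finset ℕ} {v w : ℕ}
    (hvw : v ≤ w) (hv : v ∉ A) (hw : w ∉ A) (h : insert w A ∈ H) : insert v A ∈ H := by
  rcases hvw.eq_or_lt with rfl | hlt
  · exact h
  · have := hH _ h v w hlt (mem_insert_self _ _) (by simp [hv, hlt.ne])
    rwa [erase_insert hw] at this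

/-- A family of small sets without `k` pairwise disjoint members is covered by few vertices. -/
lemma exists_cover {L : Finset (Finset ℕ)} {k d : ℕ} (hd : 1 ≤ d) (hL : ∀ A ∈ L, A.card = d)
    (hM : ∀ M ⊆ L, (M : Set (Finset ℕ)).Pairwise Disjoint → M.card ≠ k) :
    ∃ Y : Finset ℕ, Y.card ≤ k * d ∧ (∀ y ∈ Y, ∃ A ∈ L, y ∈ A) ∧ ∀ A ∈ L, ¬ Disjoint A Y := by
  classical
  obtain ⟨M, hM1, hM2⟩ := (L.powerset.filter
    (fun M : Finset (Finset ℕ) => (M : Set (Finset ℕ)).Pairwise Disjoint)).exists_max_image card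
    ⟨∅, by simp⟩
  rw [mem_filter, mem_powerset] at hM1
  refine ⟨M.biUnion id, ?_, ?_, ?_⟩
  · have hMk : M.card ≤ k := by
      by_contra hlt
      obtain ⟨M', hM', hc⟩ := exists_subset_card_eq (show k ≤ M.card by omega)
      exact hM M' (hM'.trans hM1.1) (hM1.2.mono (by exact_mod_cast hM')) hc
    calc (M.biUnion id).card ≤ M.card * d :=
          card_biUnion_le_card_mul _ _ _ (fun A hA => (hL A (hM1.1 hA)).le)
      _ ≤ k * d := Nat.mul_le_mul_right _ hMk
  · intro y hy
    obtain ⟨A, hA, hyA⟩ := mem_biUnion.1 hy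
    exact ⟨A, hM1.1 hA, hyA⟩
  · intro A hA hdis
    have hdA : ∀ B ∈ M, Disjoint A B := fun B hB => hdis.mono_right (subset_biUnion_of_mem id hB)
    have hAM : A ∉ M := by
      intro h
      have := hdA A h
      rw [disjoint_self_iff_empty] at this
      have h2 := hL A hA
      rw [this, card_empty] at h2
      omega
    have := hM2 (insert A M) ?_
    · rw [card_insert_of_notMem hAM] at this
      omega
    · rw [mem_filter, mem_powerset]
      refine ⟨insert_subset hA hM1.1, ?_⟩
      rw [coe_insert]
      refine hM1.2.insert fun B hB _ => ⟨hdA B hB, (hdA B hB).symm⟩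

/-- Structure of a shifted family with matching number at most `k`: for some `j ≤ k` the edges are
concentrated on small vertices, and, unless `j = k`, the vertices from `j` on are in no edge whose
other vertices avoid a small set `Z`. -/
lemma IsShifted.exists_split {n k r : ℕ} {H : Finset (Finset ℕ)}
    (hH : IsShifted H) (hHn : H ⊆ (range n).powersetCard r) (hm : matchingLE H k) (hr : 2 ≤ r)
    (hk : 1 ≤ k) (hn : r * (k + 1) ≤ n) :
    ∃ j ≤ k, (∀ E ∈ H,
        ∃ a, 1 ≤ a ∧ a ≤ r ∧ a ≤ (E.filter (· < j + a * (k - j + 1) - 1)).card) ∧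
      (j = k ∨ ∃ Z ⊆ range n, range k ⊆ Z ∧ Z.card ≤ 3 * k * r ∧
        ∀ v, j ≤ v → v < k → ∀ A ⊆ range n \ Z, A.card = r - 1 → insert v A ∉ H) := by
  classical
  let L : ℕ → Finset (Finset ℕ) := fun v =>
    ((range n \ range (r * (k + 1))).powersetCard (r - 1)).filter (fun A => insert v A ∈ H)
  have hLmem : ∀ v A, A ∈ L v ↔
      (A ⊆ range n \ range (r * (k + 1)) ∧ A.card = r - 1) ∧ insert v A ∈ H := by
    intro v A
    simp only [L, mem_filter, mem_powersetCard]
  have hfar : ∀ v A, A ∈ L v → ∀ x ∈ A, r * (k + 1) ≤ x := by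
    intro v A hA x hx
    have := ((hLmem v A).1 hA).1.1 hx
    simp only [mem_sdiff, mem_range] at this
    omega
  have hkN : k < r * (k + 1) := by nlinarith
  let big : ℕ → Prop := fun v =>
    ∃ M ⊆ L v, (M : Set (Finset ℕ)).Pairwise Disjoint ∧ M.card = k
  have hex : ∃ v, v = k ∨ ¬ big v := ⟨k, Or.inl rfl⟩
  obtain ⟨j, hj, hjmin⟩ : ∃ j, (j = k ∨ ¬ big j) ∧ ∀ v < j, ¬ (v = k ∨ ¬ big v) :=
    ⟨Nat.find hex, Nat.find_spec hex, fun v hv => Nat.find_min hex hv⟩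
  have hjk : j ≤ k := by
    by_contra hlt
    exact hjmin k (by omega) (Or.inl rfl)
  refine ⟨j, hjk, ?_, ?_⟩
  · have hfam : ∃ A : ℕ → Finset ℕ, (∀ i < j, A i ∈ L (j - 1)) ∧
        ∀ i < j, ∀ i' < j, i < i' → Disjoint (A i) (A i') := by
      rcases Nat.eq_zero_or_pos j with h0 | h0
      · exact ⟨fun _ => ∅, by omega, by omega⟩
      have hbig : big (j - 1) := by
        have := hjmin (j - 1) (by omega)
        push Not at this
        exact this.2
      obtain ⟨M, hML, hMd, hMc⟩ := hbig
      let e := M.equivFinOfCardEq hMc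
      refine ⟨fun i => if h : i < k then (e.symm ⟨i, h⟩ : Finset ℕ) else ∅, ?_, ?_⟩
      · intro i hi
        dsimp only
        rw [dif_pos (by omega)]
        exact hML (e.symm _).2
      · intro i hi i' hi' h
        dsimp only
        rw [dif_pos (by omega), dif_pos (by omega)]
        refine hMd (e.symm _).2 (e.symm _).2 fun heq => ?_
        have := e.symm.injective (Subtype.ext heq)
        simp only [Fin.mk.injEq] at this
        omega
    obtain ⟨A, hA, hAd⟩ := hfam
    intro E hE
    refine hH.exists_le_card_filter (fun E hE => (mem_powersetCard.1 (hHn hE)).2) hm (by omega)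
      hjk A ?_ (fun i hi x hx => hfar _ _ (hA i hi) x hx) hAd hE
    intro i hi
    have hf := hfar _ _ (hA i hi)
    refine hH.insert_mem (w := j - 1) (by omega) (fun h => ?_) (fun h => ?_)
      ((hLmem _ _).1 (hA i hi)).2
    · have := hf _ h; omega
    · have := hf _ h; omega
  · refine hj.imp_right fun hnb => ?_
    obtain ⟨Y, hY1, hY2, hY3⟩ := exists_cover (L := L j) (k := k) (d := r - 1) (by omega)
      (fun A hA => ((hLmem _ _).1 hA).1.2) (fun M h1 h2 h3 => hnb ⟨M, h1, h2, h3⟩)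
    refine ⟨range (r * (k + 1)) ∪ Y, ?_, ?_, ?_, ?_⟩
    · refine union_subset (range_mono hn) fun y hy => ?_
      obtain ⟨A, hA, hyA⟩ := hY2 y hy
      exact (mem_sdiff.1 (((hLmem _ _).1 hA).1.1 hyA)).1
    · exact (range_mono hkN.le).trans subset_union_left
    · refine (card_union_le _ _).trans ?_
      rw [card_range]
      obtain ⟨d, rfl⟩ : ∃ d, r = d + 1 := ⟨r - 1, by omega⟩
      simp only [Nat.add_sub_cancel] at hY1
      nlinarith
    · intro v hjv hvk A hA hAc hins
      have hAf : ∀ x ∈ A, r * (k + 1) ≤ x := by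
        intro x hx
        have := hA hx
        simp only [mem_sdiff, mem_union, mem_range, not_or] at this
        omega
      refine hY3 A ((hLmem _ _).2 ⟨⟨fun x hx => ?_, hAc⟩, ?_⟩) ?_
      · have := hA hx
        simp only [mem_sdiff, mem_union, not_or] at this ⊢
        tauto
      · refine hH.insert_mem hjv (fun h => ?_) (fun h => ?_) hins
        · have := hAf _ h; omega
        · have := hAf _ h; omega
      · rw [disjoint_left]
        intro x hx hxY
        have := hA hx
        simp only [mem_sdiff, mem_union, not_or] at this
        tauto

lemma exists_initial_segment (S : Finset ℕ) {u : ℕ} (hu : u ≤ S.card) :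
    ∃ T ⊆ S, T.card = u ∧ ∀ x ∈ T, ∀ y ∈ S \ T, x < y := by
  induction u with
  | zero => exact ⟨∅, by simp⟩
  | succ u ih =>
    obtain ⟨T, hT, hTc, hTlt⟩ := ih (by omega)
    have hne : (S \ T).Nonempty := by
      rw [← card_pos, card_sdiff_of_subset hT]
      omega
    obtain ⟨z, hz, hzmin⟩ := (S \ T).exists_min_image id hne
    simp only [id] at hzmin
    have hz' := mem_sdiff.1 hz
    refine ⟨insert z T, insert_subset hz'.1 hT, by rw [card_insert_of_notMem hz'.2, hTc], ?_⟩
    intro x hx y hy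
    simp only [mem_sdiff, mem_insert, not_or] at hx hy
    rcases hx with rfl | hx
    · exact lt_of_le_of_ne (hzmin y (mem_sdiff.2 ⟨hy.1, hy.2.2⟩)) (Ne.symm hy.2.1)
    · exact hTlt x hx y (mem_sdiff.2 ⟨hy.1, hy.2.2⟩)

/-- A clique with few vertices below `k` is concentrated on small vertices. -/
lemma exists_le_card_filter_of_clique {n k r s j : ℕ} {H : Finset (Finset ℕ)} (hrs : r ≤ s)
    (hjk : j ≤ k)
    (hF : ∀ E ∈ H,
        ∃ a, 1 ≤ a ∧ a ≤ r ∧ a ≤ (E.filter (· < j + a * (k - j + 1) - 1)).card)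
    {S : Finset ℕ} (hS : S ∈ natCliques n r s H) (hSk : (S.filter (· < k)).card ≤ s - r) :
    ∃ a ∈ Icc 2 r, s - r + a ≤ (S.filter (· < j + a * (k - j + 1) - 1)).card := by
  rw [mem_natCliques] at hS
  obtain ⟨-, hSc, hSH⟩ := hS
  obtain ⟨T, hTS, hTc, hTlt⟩ := exists_initial_segment S (u := s - r) (by omega)
  have hEc : (S \ T).card = r := by rw [card_sdiff_of_subset hTS]; omega
  have hkey : ∀ X a, 1 ≤ a → a ≤ ((S \ T).filter (· < X)).card →
      s - r + a ≤ (S.filter (· < X)).card := by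
    intro X a ha hle
    obtain ⟨y, hy⟩ := card_pos.1 (lt_of_lt_of_le ha hle)
    rw [mem_filter] at hy
    have hdis : Disjoint T ((S \ T).filter (· < X)) :=
      disjoint_sdiff.mono_right (filter_subset _ _)
    calc s - r + a ≤ T.card + ((S \ T).filter (· < X)).card := by omega
      _ = (T ∪ (S \ T).filter (· < X)).card := (card_union_of_disjoint hdis).symm
      _ ≤ (S.filter (· < X)).card := by
        refine card_le_card (union_subset (fun x hx => ?_)
          (filter_subset_filter _ sdiff_subset))
        exact mem_filter.2 ⟨hTS hx, (hTlt x hx y hy.1).trans hy.2⟩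
  obtain ⟨a, ha1, har, ha⟩ := hF (S \ T) (hSH _ sdiff_subset hEc)
  refine ⟨a, mem_Icc.2 ⟨?_, har⟩, hkey _ a ha1 ha⟩
  by_contra hlt
  have ha' : a = 1 := by omega
  subst ha'
  have := hkey _ 1 le_rfl ha
  rw [show j + 1 * (k - j + 1) - 1 = k by omega] at this
  omega

lemma card_concentrated_le {n s k u a X : ℕ} (ha : 1 ≤ a) :
    (((range n).powersetCard s).filter (fun S : Finset ℕ =>
      (S.filter (· < k)).card ≤ u ∧ u + a ≤ (S.filter (· < X)).card)).card ≤
      (X - k) * ((X - 1).choose (u + a - 1) * n.choose (s - (u + a))) := by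
  classical
  have hsub : (((range n).powersetCard s).filter (fun S : Finset ℕ =>
      (S.filter (· < k)).card ≤ u ∧ u + a ≤ (S.filter (· < X)).card)) ⊆
      (Ico k X).biUnion (fun w =>
        (((range X).erase w).powersetCard (u + a - 1) ×ˢ
          (range n).powersetCard (s - (u + a))).image (fun p => insert w (p.1 ∪ p.2))) := by
    intro S hS
    rw [mem_filter, mem_powersetCard] at hS
    obtain ⟨⟨hSn, hSc⟩, h1, h2⟩ := hS
    obtain ⟨w, hw, hwk⟩ : ∃ w ∈ S.filter (· < X), w ∉ S.filter (· < k) :=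
      exists_mem_notMem_of_card_lt_card (by omega)
    rw [mem_filter] at hw
    have hwk : k ≤ w := by
      by_contra hlt
      exact hwk (mem_filter.2 ⟨hw.1, by omega⟩)
    have hc : ((S.filter (· < X)).erase w).card = (S.filter (· < X)).card - 1 :=
      card_erase_of_mem (mem_filter.2 hw)
    obtain ⟨T, hT, hTc⟩ := exists_subset_card_eq
      (show u + a - 1 ≤ ((S.filter (· < X)).erase w).card by omega)
    have hTS : T ⊆ S := fun x hx => (mem_filter.1 (mem_erase.1 (hT hx)).2).1
    have hwT : w ∉ T := fun h => (mem_erase.1 (hT h)).1 rfl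
    have hins : insert w T ⊆ S := insert_subset hw.1 hTS
    rw [mem_biUnion]
    refine ⟨w, mem_Ico.2 ⟨hwk, hw.2⟩, mem_image.2 ⟨(T, S \ insert w T), ?_, ?_⟩⟩
    · rw [mem_product, mem_powersetCard, mem_powersetCard]
      refine ⟨⟨fun x hx => ?_, hTc⟩, sdiff_subset.trans hSn, ?_⟩
      · have := hT hx
        simp only [mem_erase, mem_filter, mem_range] at this ⊢
        tauto
      · change (S \ insert w T).card = _
        rw [card_sdiff_of_subset hins, card_insert_of_notMem hwT]
        omega
    · change insert w (T ∪ (S \ insert w T)) = S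
      rw [← insert_union, union_sdiff_of_subset hins]
  refine (card_le_card hsub).trans ?_
  calc _ ≤ (Ico k X).card * ((X - 1).choose (u + a - 1) * n.choose (s - (u + a))) := by
        refine card_biUnion_le_card_mul _ _ _ fun w hw => card_image_le.trans ?_
        rw [card_product, card_powersetCard, card_powersetCard, card_range,
          card_erase_of_mem (mem_range.2 (mem_Ico.1 hw).2), card_range]
    _ = _ := by rw [Nat.card_Ico]

/-- The sets of size `s` in which every `r` vertices include one below `k`. -/
def starCliques (n k r s : ℕ) : Finset (Finset ℕ) :=
  ((range n).powersetCard s).filter (fun S => s - r + 1 ≤ (S.filter (· < k)).card)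

lemma card_natCliques_sdiff_starCliques_le {n k r s j : ℕ} {H : Finset (Finset ℕ)} (hrs : r ≤ s)
    (hjk : j ≤ k)
    (hF : ∀ E ∈ H,
        ∃ a, 1 ≤ a ∧ a ≤ r ∧ a ≤ (E.filter (· < j + a * (k - j + 1) - 1)).card) :
    (natCliques n r s H \ starCliques n k r s).card ≤
      ∑ a ∈ Icc 2 r, (a - 1) * (k - j + 1) *
        ((a * k + (a - 2)).choose (s - r + 1 + (a - 2)) * n.choose (r - a)) := by
  classical
  have hsub : natCliques n r s H \ starCliques n k r s ⊆ (Icc 2 r).biUnion (fun a =>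
      ((range n).powersetCard s).filter (fun S : Finset ℕ => (S.filter (· < k)).card ≤ s - r ∧
        s - r + a ≤ (S.filter (· < j + a * (k - j + 1) - 1)).card)) := by
    intro S hS
    rw [mem_sdiff] at hS
    obtain ⟨hS1, hS2⟩ := hS
    have hSm := mem_natCliques.1 hS1
    have hSp : S ∈ (range n).powersetCard s := mem_powersetCard.2 ⟨hSm.1, hSm.2.1⟩
    have hSk : (S.filter (· < k)).card ≤ s - r := by
      by_contra hlt
      exact hS2 (mem_filter.2 ⟨hSp, by omega⟩)
    obtain ⟨a, ha, hle⟩ := exists_le_card_filter_of_clique hrs hjk hF hS1 hSk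
    exact mem_biUnion.2 ⟨a, ha, mem_filter.2 ⟨hSp, hSk, hle⟩⟩
  refine (card_le_card hsub).trans (card_biUnion_le.trans (sum_le_sum fun a ha => ?_))
  rw [mem_Icc] at ha
  refine (card_concentrated_le (by omega)).trans ?_
  have e1 : j + a * (k - j + 1) - 1 - k = (a - 1) * (k - j + 1) := by
    obtain ⟨b, rfl⟩ : ∃ b, a = b + 1 := ⟨a - 1, by omega⟩
    rw [add_mul, Nat.add_sub_cancel]
    omega
  have e2 : j + a * (k - j + 1) - 1 - 1 ≤ a * k + (a - 2) := by
    obtain ⟨m, rfl⟩ : ∃ m, k = j + m := ⟨k - j, by omega⟩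
    rw [Nat.add_sub_cancel_left]
    have : j ≤ a * j := Nat.le_mul_of_pos_left _ (by omega)
    rw [mul_add, mul_add]
    omega
  have e3 : s - r + a - 1 = s - r + 1 + (a - 2) := by omega
  have e4 : s - (s - r + a) = r - a := by omega
  rw [e1, e3, e4]
  gcongr

lemma le_card_starCliques_sdiff_natCliques {n k r s j : ℕ} {H : Finset (Finset ℕ)} (hr : 1 ≤ r)
    (hrs : r ≤ s) (hjk : j ≤ k) {Z : Finset ℕ} (hZn : Z ⊆ range n) (hkZ : range k ⊆ Z)
    (hZ : ∀ v, j ≤ v → v < k → ∀ A ⊆ range n \ Z, A.card = r - 1 → insert v A ∉ H) :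
    (k.choose (s - r + 1) - j.choose (s - r + 1)) * (n - Z.card).choose (r - 1) ≤
      (starCliques n k r s \ natCliques n r s H).card := by
  classical
  have hcard : (((range k).powersetCard (s - r + 1) \ (range j).powersetCard (s - r + 1)) ×ˢ
      (range n \ Z).powersetCard (r - 1)).card =
      (k.choose (s - r + 1) - j.choose (s - r + 1)) * (n - Z.card).choose (r - 1) := by
    rw [card_product, card_sdiff_of_subset (powersetCard_mono (range_mono hjk)),
      card_powersetCard, card_powersetCard, card_powersetCard, card_sdiff_of_subset hZn,
      card_range, card_range, card_range]
  rw [← hcard]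
  refine card_le_card_of_injOn (fun p => p.1 ∪ p.2) ?_ ?_
  · rintro ⟨T, A⟩ hp
    simp only [coe_product, Set.mem_prod, mem_coe, mem_sdiff, mem_powersetCard, not_and] at hp
    obtain ⟨⟨⟨hTk, hTc⟩, hTj⟩, hA, hAc⟩ := hp
    have hTZ := hTk.trans hkZ
    have hdis : Disjoint T A := disjoint_sdiff.mono hTZ hA
    have hsub : T ∪ A ⊆ range n := union_subset (hTZ.trans hZn) (hA.trans sdiff_subset)
    simp only [mem_coe, mem_sdiff]
    constructor
    · refine mem_filter.2 ⟨mem_powersetCard.2 ⟨hsub, ?_⟩, ?_⟩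
      · rw [card_union_of_disjoint hdis]
        omega
      · rw [← hTc]
        exact card_le_card fun x hx => mem_filter.2 ⟨mem_union_left _ hx, mem_range.1 (hTk hx)⟩
    · intro hcl
      obtain ⟨v, hvT, hvj⟩ : ∃ v ∈ T, v ∉ range j := by
        by_contra! hcon
        exact hTj hcon hTc
      have hvA : v ∉ A := disjoint_left.1 hdis hvT
      refine hZ v (by simpa using hvj) (mem_range.1 (hTk hvT)) A hA hAc
        ((mem_natCliques.1 hcl).2.2 _ ?_ ?_)
      · exact insert_subset (mem_union_left _ hvT) subset_union_right
      · rw [card_insert_of_notMem hvA]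
        omega
  · rintro ⟨T, A⟩ hp ⟨T', A'⟩ hp' heq
    simp only [coe_product, Set.mem_prod, mem_coe, mem_sdiff, mem_powersetCard] at hp hp'
    simp only at heq
    have h1 := hp.1.1.1.trans hkZ
    have h1' := hp'.1.1.1.trans hkZ
    have h2 := hp.2.1
    have h2' := hp'.2.1
    have hx : ∀ x, x ∈ T ∪ A ↔ x ∈ T' ∪ A' := fun x => by rw [heq]
    rw [Prod.mk.injEq]
    constructor <;> ext x <;> have := hx x <;> have := @h1 x <;> have := @h1' x <;>
      have := @h2 x <;> have := @h2' x <;> simp only [mem_union, mem_sdiff] at * <;> tauto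

lemma choose_add_le_mul_pow {N t : ℕ} (hN : 1 ≤ N) (ht : 1 ≤ t) (b : ℕ) :
    (N + b).choose (t + b) ≤ N.choose t * N ^ b := by
  induction b with
  | zero => simp
  | succ b ih =>
    have h1 := Nat.add_one_mul_choose_eq (N + b) (t + b)
    have h2 : N + b + 1 ≤ N * (t + b + 1) := by nlinarith
    refine Nat.le_of_mul_le_mul_right (c := t + b + 1) ?_ (by omega)
    calc (N + (b + 1)).choose (t + (b + 1)) * (t + b + 1)
        = (N + b + 1) * (N + b).choose (t + b) := h1.symm
      _ ≤ (N * (t + b + 1)) * (N.choose t * N ^ b) := Nat.mul_le_mul h2 ih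
      _ = N.choose t * N ^ (b + 1) * (t + b + 1) := by ring

lemma pow_le_choose_mul_pow {k t : ℕ} (htk : t ≤ k) : k ^ t ≤ k.choose t * t ^ t := by
  induction t generalizing k with
  | zero => simp
  | succ t ih =>
    obtain ⟨k, rfl⟩ : ∃ l, k = l + 1 := ⟨k - 1, by omega⟩
    have key : (k + 1) ^ t ≤ k.choose t * (t + 1) ^ t := by
      rcases Nat.eq_zero_or_pos t with rfl | ht
      · simp
      refine Nat.le_of_mul_le_mul_right (c := t ^ t) ?_ (by positivity)
      calc (k + 1) ^ t * t ^ t = ((k + 1) * t) ^ t := (mul_pow _ _ _).symm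
        _ ≤ (k * (t + 1)) ^ t := Nat.pow_le_pow_left (by nlinarith) _
        _ = k ^ t * (t + 1) ^ t := mul_pow _ _ _
        _ ≤ k.choose t * t ^ t * (t + 1) ^ t := Nat.mul_le_mul_right _ (ih (by omega))
        _ = k.choose t * (t + 1) ^ t * t ^ t := by ring
    calc (k + 1) ^ (t + 1) = (k + 1) * (k + 1) ^ t := by ring
      _ ≤ (k + 1) * (k.choose t * (t + 1) ^ t) := Nat.mul_le_mul_left _ key
      _ = (k + 1) * k.choose t * (t + 1) ^ t := by ring
      _ = (k + 1).choose (t + 1) * (t + 1) ^ (t + 1) := by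
        rw [Nat.add_one_mul_choose_eq]; ring

lemma choose_mul_le_exp_mul_pow {k t : ℕ} (htk : t ≤ k) (a : ℕ) :
    ((a * k).choose t : ℝ) ≤ (Real.exp 1 * a) ^ t * k.choose t := by
  have h1 : ((a * k).choose t : ℝ) ≤ ((a * k : ℕ) : ℝ) ^ t / (t.factorial : ℝ) :=
    Nat.choose_le_pow_div t (a * k)
  have h2 : (k : ℝ) ^ t ≤ k.choose t * (t : ℝ) ^ t := by exact_mod_cast pow_le_choose_mul_pow htk
  have h3 : (t : ℝ) ^ t / (t.factorial : ℝ) ≤ Real.exp 1 ^ t := by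
    rw [Real.exp_one_pow]
    exact Real.pow_div_factorial_le_exp (t : ℝ) (Nat.cast_nonneg t) t
  calc ((a * k).choose t : ℝ) ≤ ((a * k : ℕ) : ℝ) ^ t / (t.factorial : ℝ) := h1
    _ = (a : ℝ) ^ t * (k : ℝ) ^ t / (t.factorial : ℝ) := by push_cast; rw [mul_pow]
    _ ≤ (a : ℝ) ^ t * (k.choose t * (t : ℝ) ^ t) / (t.factorial : ℝ) := by gcongr
    _ = (a : ℝ) ^ t * k.choose t * ((t : ℝ) ^ t / (t.factorial : ℝ)) := by ring
    _ ≤ (a : ℝ) ^ t * k.choose t * Real.exp 1 ^ t := by gcongr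
    _ = (Real.exp 1 * a) ^ t * k.choose t := by rw [mul_pow]; ring

lemma choose_mul_sub_pow_le {n r u : ℕ} (b : ℕ) (hub : u + b ≤ r) :
    n.choose u * (n - r) ^ b ≤ r ^ b * n.choose (u + b) := by
  induction b with
  | zero => simp
  | succ b ih =>
    have h1 := Nat.choose_succ_right_eq n (u + b)
    calc n.choose u * (n - r) ^ (b + 1) = n.choose u * (n - r) ^ b * (n - r) := by ring
      _ ≤ r ^ b * n.choose (u + b) * (n - (u + b)) :=
        Nat.mul_le_mul (ih (by omega)) (by omega)
      _ = r ^ b * (n.choose (u + b + 1) * (u + b + 1)) := by rw [h1]; ring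
      _ ≤ r ^ b * (n.choose (u + b + 1) * r) := by gcongr; omega
      _ = r ^ (b + 1) * n.choose (u + (b + 1)) := by rw [← add_assoc]; ring

lemma mul_choose_le_mul_choose {j k t : ℕ} (hjk : j ≤ k) (ht : 1 ≤ t) :
    k * j.choose t ≤ j * k.choose t := by
  rcases Nat.eq_zero_or_pos j with rfl | hj
  · rw [Nat.choose_eq_zero_of_lt ht]; simp
  obtain ⟨j, rfl⟩ : ∃ l, j = l + 1 := ⟨j - 1, by omega⟩
  obtain ⟨k, rfl⟩ : ∃ l, k = l + 1 := ⟨k - 1, by omega⟩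
  obtain ⟨t, rfl⟩ : ∃ l, t = l + 1 := ⟨t - 1, by omega⟩
  refine Nat.le_of_mul_le_mul_right (c := t + 1) ?_ (by omega)
  rw [mul_assoc, mul_assoc, ← Nat.add_one_mul_choose_eq, ← Nat.add_one_mul_choose_eq,
    mul_left_comm]
  gcongr
  omega

lemma choose_succ_le_choose_sub_add {n u : ℕ} (z : ℕ) (hz : z ≤ n) :
    n.choose (u + 1) ≤ (n - z).choose (u + 1) + z * (n - 1).choose u := by
  induction z with
  | zero => simp
  | succ z ih =>
    have h1 := ih (by omega)
    have h2 : (n - z).choose (u + 1) =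
        (n - (z + 1)).choose u + (n - (z + 1)).choose (u + 1) := by
      rw [← Nat.choose_succ_succ']
      congr 1
      omega
    have h3 : (n - (z + 1)).choose u ≤ (n - 1).choose u := Nat.choose_le_choose u (by omega)
    rw [add_mul, one_mul]
    omega

lemma sum_Icc_eighth_pow_le (r : ℕ) : ∑ a ∈ Icc 2 r, (1 / 8 : ℝ) ^ (a - 1) ≤ 1 / 7 := by
  rcases Nat.eq_zero_or_pos r with rfl | hr
  · norm_num
  suffices h : ∑ a ∈ Icc 2 r, (1 / 8 : ℝ) ^ (a - 1) ≤ 1 / 7 - 1 / 7 * (1 / 8) ^ (r - 1) by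
    have : (0 : ℝ) ≤ 1 / 7 * (1 / 8) ^ (r - 1) := by positivity
    linarith
  induction r, hr using Nat.le_induction with
  | base => norm_num
  | succ r hr ih =>
    rw [sum_Icc_succ_top (by omega)]
    obtain ⟨q, rfl⟩ : ∃ q, r = q + 1 := ⟨r - 1, by omega⟩
    simp only [Nat.add_sub_cancel] at ih ⊢
    rw [pow_succ]
    linarith

lemma concentrated_term_le {n k r t m a : ℕ} (ht : 1 ≤ t) (htk : t ≤ k) (hm : 1 ≤ m)
    (ha : 2 ≤ a) (har : a ≤ r) (hrn : r ≤ n)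
    (hn : 8 * (Real.exp 1 * r) ^ t * k * r ≤ (n : ℝ) - r) :
    (k : ℝ) * (((a - 1) * (m + 1) * ((a * k + (a - 2)).choose (t + (a - 2)) * n.choose (r - a)) :
      ℕ) : ℝ) ≤ 2 * m * k.choose t * n.choose (r - 1) * (1 / 8) ^ (a - 1) := by
  obtain ⟨b, rfl⟩ : ∃ b, a = b + 2 := ⟨a - 2, by omega⟩
  simp only [Nat.add_sub_cancel, show b + 2 - 1 = b + 1 by omega]
  have he : (2 : ℝ) ≤ Real.exp 1 := by linarith [Real.exp_one_gt_d9]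
  have hk : (1 : ℝ) ≤ k := by exact_mod_cast ht.trans htk
  have hr : (1 : ℝ) ≤ r := by exact_mod_cast (by omega : 1 ≤ r)
  have hm' : (1 : ℝ) ≤ m := by exact_mod_cast hm
  have harR : ((b + 2 : ℕ) : ℝ) ≤ r := by exact_mod_cast har
  have her : 1 ≤ Real.exp 1 * r := by nlinarith
  set Q := (Real.exp 1 * r) ^ t with hQ
  have hQ1 : Real.exp 1 * r ≤ Q := le_self_pow₀ her (by omega)
  have hQ0 : 0 < Q := by linarith
  have hC1 : (((b + 2) * k + b).choose (t + b) : ℝ) ≤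
      Q * k.choose t * (((b + 2 : ℕ) : ℝ) * k) ^ b := by
    have h1 : (((b + 2) * k + b).choose (t + b) : ℝ) ≤
        ((b + 2) * k).choose t * (((b + 2 : ℕ) : ℝ) * k) ^ b := by
      exact_mod_cast choose_add_le_mul_pow (by nlinarith) ht b
    have h2 := choose_mul_le_exp_mul_pow htk (b + 2)
    have h3 : (Real.exp 1 * ((b + 2 : ℕ) : ℝ)) ^ t ≤ Q := by
      rw [hQ]; gcongr
    refine h1.trans ?_
    gcongr
    exact h2.trans (by gcongr)
  have hb : ((b + 1 : ℕ) : ℝ) ≤ Real.exp 1 ^ b := by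
    have h1 : ((b + 1 : ℕ) : ℝ) ≤ 2 ^ b := by exact_mod_cast Nat.lt_two_pow_self
    exact h1.trans (by gcongr)
  have hA : (k : ℝ) * ((b + 1 : ℕ) : ℝ) * (((b + 2) * k + b).choose (t + b) : ℝ) ≤
      (Q * k) ^ (b + 1) * k.choose t := by
    calc (k : ℝ) * ((b + 1 : ℕ) : ℝ) * (((b + 2) * k + b).choose (t + b) : ℝ)
        ≤ k * Real.exp 1 ^ b * (Q * k.choose t * (((b + 2 : ℕ) : ℝ) * k) ^ b) := by gcongr
      _ = (Real.exp 1 * ((b + 2 : ℕ) : ℝ)) ^ b * (Q * k ^ (b + 1) * k.choose t) := by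
        rw [mul_pow, mul_pow]; ring
      _ ≤ Q ^ b * (Q * k ^ (b + 1) * k.choose t) := by
        gcongr
        exact le_trans (by gcongr) hQ1
      _ = (Q * k) ^ (b + 1) * k.choose t := by rw [mul_pow]; ring
  have hC2 : (n.choose (r - (b + 2)) : ℝ) * (8 * Q * k) ^ (b + 1) ≤ n.choose (r - 1) := by
    have h1 : (n.choose (r - (b + 2)) : ℝ) * ((n : ℝ) - r) ^ (b + 1) ≤
        (r : ℝ) ^ (b + 1) * n.choose (r - 1) := by
      have := choose_mul_sub_pow_le (n := n) (r := r) (u := r - (b + 2)) (b + 1) (by omega)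
      rw [show r - (b + 2) + (b + 1) = r - 1 by omega] at this
      rw [← Nat.cast_sub hrn]
      exact_mod_cast this
    have hr0 : (0 : ℝ) < (r : ℝ) ^ (b + 1) := by positivity
    refine le_of_mul_le_mul_left ?_ hr0
    calc (r : ℝ) ^ (b + 1) * ((n.choose (r - (b + 2)) : ℝ) * (8 * Q * k) ^ (b + 1))
        = (n.choose (r - (b + 2)) : ℝ) * (8 * Q * k * r) ^ (b + 1) := by
          rw [mul_pow (8 * Q * k) (r : ℝ)]; ring
      _ ≤ (n.choose (r - (b + 2)) : ℝ) * ((n : ℝ) - r) ^ (b + 1) := by gcongr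
      _ ≤ _ := h1
  have hm2 : ((m + 1 : ℕ) : ℝ) ≤ 2 * m := by push_cast; linarith
  push_cast at hA hm2 ⊢
  calc (k : ℝ) * (((b : ℝ) + 1) * ((m : ℝ) + 1) *
        ((((b + 2) * k + b).choose (t + b) : ℝ) * (n.choose (r - (b + 2)) : ℝ)))
      = ((m : ℝ) + 1) * ((k : ℝ) * ((b : ℝ) + 1) * (((b + 2) * k + b).choose (t + b) : ℝ)) *
          (n.choose (r - (b + 2)) : ℝ) := by ring
    _ ≤ (2 * m) * ((Q * k) ^ (b + 1) * k.choose t) * (n.choose (r - (b + 2)) : ℝ) := by gcongr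
    _ = 2 * m * k.choose t * ((n.choose (r - (b + 2)) : ℝ) * (8 * Q * k) ^ (b + 1)) *
          (1 / 8) ^ (b + 1) := by
        rw [show 8 * Q * (k : ℝ) = 8 * (Q * k) by ring, mul_pow 8 (Q * (k : ℝ)), one_div, inv_pow]
        field_simp
    _ ≤ 2 * m * k.choose t * n.choose (r - 1) * (1 / 8) ^ (b + 1) := by gcongr

lemma half_choose_le_choose_sub {n k r z : ℕ} (hr : 2 ≤ r) (hz : z ≤ 3 * k * r) (hzn : z ≤ n)
    (hn : 6 * k * r * r ≤ n) : n.choose (r - 1) ≤ 2 * (n - z).choose (r - 1) := by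
  rcases Nat.eq_zero_or_pos n with rfl | hn0
  · simp only [Nat.zero_sub]
    omega
  obtain ⟨u, rfl⟩ : ∃ u, r = u + 2 := ⟨r - 2, by omega⟩
  rw [show u + 2 - 1 = u + 1 by omega]
  have h1 := choose_succ_le_choose_sub_add (u := u) z hzn
  have h2 : n * (n - 1).choose u = n.choose (u + 1) * (u + 1) := by
    have := Nat.add_one_mul_choose_eq (n - 1) u
    rwa [Nat.sub_add_cancel hn0] at this
  have h3 : 2 * (z * (n - 1).choose u) ≤ n.choose (u + 1) := by
    refine Nat.le_of_mul_le_mul_left (c := n) ?_ hn0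
    calc n * (2 * (z * (n - 1).choose u)) = 2 * z * (n * (n - 1).choose u) := by ring
      _ = 2 * z * (u + 1) * n.choose (u + 1) := by rw [h2]; ring
      _ ≤ n * n.choose (u + 1) := by
        gcongr
        nlinarith
  omega

/-- A shifted family of matching number at most `k` has at most as many cliques as the family of
all edges meeting `{0, …, k - 1}`. -/
lemma IsShifted.card_natCliques_le {n k r s : ℕ} {H : Finset (Finset ℕ)} (hk : 1 ≤ k) (hr : 1 ≤ r)
    (hrs : r ≤ s) (hsk : s ≤ k + r - 1) (hH : IsShifted H) (hHn : H ⊆ (range n).powersetCard r)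
    (hm : matchingLE H k) (hn : 4 * (Real.exp 1 * r) ^ (s - r + 2) * k ≤ (n : ℝ)) :
    (natCliques n r s H).card ≤ (starCliques n k r s).card := by
  classical
  rw [← card_sdiff_le_card_sdiff_iff]
  rcases hr.eq_or_lt with rfl | hr2
  · have := card_natCliques_sdiff_starCliques_le (n := n) (j := 0) hrs (Nat.zero_le k)
      (fun E hE => hH.exists_le_card_filter (fun E hE => (mem_powersetCard.1 (hHn hE)).2) hm hr
        (Nat.zero_le k) (fun _ => ∅) (by omega) (by omega) (by omega) hE)
    simp only [Icc_eq_empty (show ¬ 2 ≤ 1 by omega), sum_empty] at this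
    omega
  obtain ⟨t, ht⟩ : ∃ t, t = s - r + 1 := ⟨_, rfl⟩
  have hkR : (1 : ℝ) ≤ k := by exact_mod_cast hk
  have hrR : (1 : ℝ) ≤ r := by exact_mod_cast hr
  have he : (2.7 : ℝ) ≤ Real.exp 1 := by linarith [Real.exp_one_gt_d9]
  have her : 2.7 * (r : ℝ) ≤ Real.exp 1 * r := by gcongr
  set Q := (Real.exp 1 * r) ^ t with hQ
  have hQ1 : 2.7 * (r : ℝ) ≤ Q :=
    her.trans (le_self_pow₀ (by linarith) (by omega))
  have hrk : (r : ℝ) ≤ r * k := le_mul_of_one_le_right (by linarith) hkR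
  have hnQ : 10.8 * (Q * (r * k)) ≤ (n : ℝ) := by
    refine le_trans ?_ hn
    rw [show s - r + 2 = t + 1 by omega, pow_succ, ← hQ]
    have h : 0 ≤ Q * (r * k) := by nlinarith
    nlinarith
  have hnrk : 29 * (r * (r * k)) ≤ (n : ℝ) := by nlinarith
  have hn6 : 6 * k * r * r ≤ n := by
    have : (6 * k * r * r : ℝ) ≤ n := by nlinarith
    exact_mod_cast this
  have hrn : r ≤ n := by
    have : (r : ℝ) ≤ n := by nlinarith
    exact_mod_cast this
  have hn8 : 8 * Q * k * r ≤ (n : ℝ) - r := by nlinarith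
  obtain ⟨j, hjk, hF, hZ⟩ := hH.exists_split hHn hm hr2 hk (by nlinarith)
  rcases hjk.eq_or_lt with rfl | hjk'
  · have hsub : natCliques n r s H ⊆ starCliques n j r s := by
      intro S hS
      have hSm := mem_natCliques.1 hS
      by_contra hns
      have hSk : (S.filter (· < j)).card ≤ s - r := by
        by_contra hlt
        exact hns (mem_filter.2 ⟨mem_powersetCard.2 ⟨hSm.1, hSm.2.1⟩, by omega⟩)
      obtain ⟨a, ha, hle⟩ := exists_le_card_filter_of_clique hrs le_rfl hF hS hSk
      rw [mem_Icc] at ha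
      have h1 : S.filter (· < j + a * (j - j + 1) - 1) ⊆
          S.filter (· < j) ∪ Ico j (j + a - 1) := by
        intro x hx
        simp only [mem_union, mem_filter, mem_Ico, Nat.sub_self, zero_add, mul_one] at hx ⊢
        rcases lt_or_ge x j with h | h
        · exact Or.inl ⟨hx.1, h⟩
        · exact Or.inr ⟨h, by omega⟩
      have h2 := (card_le_card h1).trans (card_union_le _ _)
      rw [Nat.card_Ico] at h2
      omega
    rw [sdiff_eq_empty_iff_subset.2 hsub]
    simp
  obtain ⟨Z, hZn, hkZ, hZc, hZ⟩ := hZ.resolve_left hjk'.ne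
  have hextra := card_natCliques_sdiff_starCliques_le (n := n) hrs hjk hF
  have hmiss := le_card_starCliques_sdiff_natCliques hr hrs hjk hZn hkZ hZ
  rw [← ht] at hextra hmiss
  have hZn' : Z.card ≤ n := by simpa using card_le_card hZn
  have hhalf := half_choose_le_choose_sub hr2 hZc hZn' hn6
  have hcj := mul_choose_le_mul_choose hjk (show 1 ≤ t by omega)
  have hcjk : j.choose t ≤ k.choose t := Nat.choose_le_choose t hjk
  set C := (n - Z.card).choose (r - 1)
  set D := n.choose (r - 1)
  obtain ⟨m, hmk⟩ : ∃ m, m = k - j := ⟨_, rfl⟩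
  rw [← hmk] at hextra
  have hmR : (m : ℝ) = k - j := by rw [hmk, Nat.cast_sub hjk]
  have hX : (k : ℝ) * (natCliques n r s H \ starCliques n k r s).card ≤
      2 / 7 * (m * k.choose t * D) := by
    calc (k : ℝ) * (natCliques n r s H \ starCliques n k r s).card
        ≤ k * ((∑ a ∈ Icc 2 r, (a - 1) * (m + 1) *
          ((a * k + (a - 2)).choose (t + (a - 2)) * n.choose (r - a)) : ℕ) : ℝ) := by
          gcongr
      _ ≤ ∑ a ∈ Icc 2 r, (2 * m * k.choose t * D * (1 / 8) ^ (a - 1) : ℝ) := by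
          rw [Nat.cast_sum, mul_sum]
          refine sum_le_sum fun a ha => ?_
          rw [mem_Icc] at ha
          exact concentrated_term_le (by omega) (by omega) (by omega) ha.1 ha.2 hrn hn8
      _ = 2 * m * k.choose t * D * ∑ a ∈ Icc 2 r, (1 / 8 : ℝ) ^ (a - 1) := by rw [mul_sum]
      _ ≤ 2 * m * k.choose t * D * (1 / 7) := by
          gcongr
          exact sum_Icc_eighth_pow_le r
      _ = _ := by ring
  have hY : (1 / 2 * (m * k.choose t * D) : ℝ) ≤
      (k : ℝ) * (starCliques n k r s \ natCliques n r s H).card := by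
    have h1 : ((k.choose t : ℝ) - j.choose t) * C ≤
        (starCliques n k r s \ natCliques n r s H).card := by
      rw [← Nat.cast_sub hcjk]
      exact_mod_cast hmiss
    have h2 : (m : ℝ) * k.choose t ≤ k * ((k.choose t : ℝ) - j.choose t) := by
      have : (k : ℝ) * j.choose t ≤ j * k.choose t := by exact_mod_cast hcj
      rw [hmR]
      linarith
    have h3 : (D : ℝ) ≤ 2 * C := by exact_mod_cast hhalf
    calc (1 / 2 * (m * k.choose t * D) : ℝ)
        ≤ (1 / 2 * (m * k.choose t * (2 * C)) : ℝ) := by gcongr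
      _ = (m * k.choose t * C : ℝ) := by ring
      _ ≤ k * ((k.choose t : ℝ) - j.choose t) * C := by gcongr
      _ = k * (((k.choose t : ℝ) - j.choose t) * C) := by ring
      _ ≤ _ := by gcongr
  have hpos : (0 : ℝ) ≤ m * k.choose t * D := by positivity
  have hfin : (k : ℝ) * (natCliques n r s H \ starCliques n k r s).card ≤
      k * (starCliques n k r s \ natCliques n r s H).card := by linarith
  have := le_of_mul_le_mul_left hfin (by linarith)
  exact_mod_cast this

lemma cliqueCount_le_card_natCliques {V : Type*} [Fintype V] [DecidableEq V] {n : ℕ} (r s : ℕ)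
    (H : Finset (Finset V)) (e : V ↪ ℕ) (he : ∀ v, e v < n) :
    cliqueCount r s H ≤ (natCliques n r s (H.map (mapEmbedding e).toEmbedding)).card := by
  refine card_le_card_of_injOn (fun S => S.map e) ?_ ((map_injective e).injOn)
  intro S hS
  simp only [coe_filter, Set.mem_ofPred_eq, mem_powersetCard] at hS
  rw [mem_coe, mem_natCliques]
  refine ⟨?_, by rw [card_map, hS.1.2], ?_⟩
  · intro x hx
    obtain ⟨v, -, rfl⟩ := mem_map.1 hx
    exact mem_range.2 (he v)
  · intro E hE hEr
    obtain ⟨E', hE', rfl⟩ := subset_map_iff.1 hE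
    rw [card_map] at hEr
    exact mem_map.2 ⟨E', hS.2 (mem_powersetCard.2 ⟨hE', hEr⟩), rfl⟩

lemma matchingLE.map {V : Type*} {H : Finset (Finset V)} {k : ℕ} (hH : matchingLE H k)
    (e : V ↪ ℕ) : matchingLE (H.map (mapEmbedding e).toEmbedding) k := by
  intro M hM hd
  obtain ⟨M', hM', rfl⟩ := subset_map_iff.1 hM
  rw [card_map]
  refine hH M' hM' fun A hA B hB hAB => ?_
  refine (disjoint_map e).1 (hd ?_ ?_ ((map_injective e).ne hAB))
  · exact mem_coe.2 (mem_map.2 ⟨A, hA, rfl⟩)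
  · exact mem_coe.2 (mem_map.2 ⟨B, hB, rfl⟩)

lemma card_starCliques_le_cliqueCount {n k r s : ℕ} (hrs : r ≤ s) :
    (starCliques n k r s).card ≤ cliqueCount r s (Fnka n k r 1) := by
  have hmap : ∀ S ⊆ range n,
      ((univ : Finset (Fin n)).filter (fun x : Fin n => (x : ℕ) ∈ S)).map Fin.valEmbedding = S := by
    intro S hS
    ext x
    simp only [mem_map, mem_filter, mem_univ, true_and, Fin.valEmbedding_apply]
    constructor
    · rintro ⟨y, hy, rfl⟩
      exact hy
    · intro hx
      exact ⟨⟨x, mem_range.1 (hS hx)⟩, hx, rfl⟩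
  have hsub : ∀ S ∈ starCliques n k r s, S ⊆ range n := fun S hS =>
    (mem_powersetCard.1 (mem_filter.1 hS).1).1
  refine card_le_card_of_injOn
    (fun S => (univ : Finset (Fin n)).filter (fun x : Fin n => (x : ℕ) ∈ S)) ?_ ?_
  · intro S hS
    have hSn := hsub S hS
    obtain ⟨hSp, hSk⟩ := mem_filter.1 (mem_coe.1 hS)
    have hSc := (mem_powersetCard.1 hSp).2
    simp only [coe_filter, Set.mem_ofPred_eq, mem_powersetCard, subset_univ, true_and]
    refine ⟨by rw [← card_map Fin.valEmbedding, hmap S hSn, hSc], ?_⟩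
    intro E hE
    obtain ⟨hES, hEr⟩ := mem_powersetCard.1 hE
    refine mem_filter.2 ⟨mem_powersetCard.2 ⟨subset_univ _, hEr⟩, ?_⟩
    rw [Nat.one_le_iff_ne_zero, ← Nat.pos_iff_ne_zero, card_pos]
    have hES' : E.map Fin.valEmbedding ⊆ S := by
      rw [← hmap S hSn]
      exact map_subset_map.2 hES
    obtain ⟨x, hxE, hxk⟩ : ∃ x ∈ E.map Fin.valEmbedding, x < k := by
      by_contra! hcon
      have hdis : Disjoint (E.map Fin.valEmbedding) (S.filter (· < k)) := by
        rw [disjoint_left]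
        intro x hx hx'
        exact absurd (mem_filter.1 hx').2 (not_lt.2 (hcon x hx))
      have := card_le_card (union_subset hES' (filter_subset (· < k) S))
      rw [card_union_of_disjoint hdis, card_map] at this
      omega
    obtain ⟨y, hy, rfl⟩ := mem_map.1 hxE
    refine ⟨y, mem_filter.2 ⟨hy, ?_⟩⟩
    simp only [Fin.valEmbedding_apply] at hxk
    omega
  · intro S hS S' hS' heq
    simp only at heq
    rw [← hmap S (hsub S hS), ← hmap S' (hsub S' hS'), heq]

/-- Theorem 1.3 (I). -/
theorem max_cliques_small_s {V : Type*} [Fintype V] [DecidableEq V] {n k r s : ℕ}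
    (hn0 : 0 < n) (hk0 : 0 < k) (hr0 : 0 < r) (hs0 : 0 < s)
    (hrs : r ≤ s) (hsk : s ≤ k + r - 1)
    (hcard : Fintype.card V = n)
    (H : Finset (Finset V)) (hunif : ∀ E ∈ H, E.card = r)
    (hmatch : matchingLE H k)
    (hn : 4 * (Real.exp 1 * r) ^ (s - r + 2) * k ≤ (n : ℝ)) :
    cliqueCount r s H ≤ cliqueCount r s (Fnka n k r 1) := by
  let e : V ↪ ℕ := (Fintype.equivFinOfCardEq hcard).toEmbedding.trans Fin.valEmbedding
  have he : ∀ v, e v < n := fun v => (Fintype.equivFinOfCardEq hcard v).isLt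
  have hsub : H.map (mapEmbedding e).toEmbedding ⊆ (range n).powersetCard r := by
    intro E hE
    obtain ⟨E', hE', rfl⟩ := mem_map.1 hE
    refine mem_powersetCard.2 ⟨fun x hx => ?_, (card_map e).trans (hunif E' hE')⟩
    obtain ⟨v, -, rfl⟩ := mem_map.1 hx
    exact mem_range.2 (he v)
  obtain ⟨G, hGn, hGm, hGs, hle⟩ := exists_isShifted s _ hsub (hmatch.map e)
  calc cliqueCount r s H
      ≤ (natCliques n r s (H.map (mapEmbedding e).toEmbedding)).card :=
        cliqueCount_le_card_natCliques r s H e he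
    _ ≤ (natCliques n r s G).card := hle
    _ ≤ (starCliques n k r s).card := hGs.card_natCliques_le hk0 hr0 hrs hsk hGn hGm hn
    _ ≤ cliqueCount r s (Fnka n k r 1) := card_starCliques_le_cliqueCount hrs
end

section
/- Let n, k, r, t be positive integers such that r ≤ t ≤ k + r − 2 and n ≥ 4k(t−r+2)(e·r)^{t−r+2} (where e is Euler's number). Let F_1, F_2, …, F_k be r-graphs on a common vertex set V of size n. Suppose that for every i ∈ {1, 2, …, k} there exists some s ∈ {r, r+1, …, t} such that K_s^r(F_i) > K_s^r(F^{(r)}_{n,k−1,1}). Then there exist pairwise disjoint edges F_1 ∈ F_1, …, F_k ∈ F_k (a rainbow matching). -/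
open Finset

theorem div_pow_le_choose (n k : ℕ) (hk : k ≤ n) :
    ((n + 1 : ℝ) / (k + 1)) ^ k ≤ n.choose k := by
  induction k generalizing n with
  | zero => simp
  | succ k ih =>
    obtain ⟨n, rfl⟩ : ∃ m, n = m + 1 := ⟨n - 1, by omega⟩
    have hkn : (k : ℝ) ≤ n := by exact_mod_cast (by omega : k ≤ n)
    have hrec : ((n : ℝ) + 1) * n.choose k = (n + 1).choose (k + 1) * (k + 1) := by
      exact_mod_cast Nat.add_one_mul_choose_eq n k
    have hle : ((n : ℝ) + 1 + 1) / (k + 1 + 1) ≤ (n + 1) / (k + 1) := by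
      rw [div_le_div_iff₀ (by positivity) (by positivity)]
      nlinarith
    have heq : ((n + 1).choose (k + 1) : ℝ) = (n + 1) / (k + 1) * n.choose k := by
      field_simp
      linarith
    push_cast
    rw [heq, pow_succ']
    gcongr
    exact (pow_le_pow_left₀ (by positivity) hle k).trans (ih n (by omega))

theorem choose_mul_le_exp_mul (r K m : ℕ) (hm : m ≤ K) :
    ((r * (K + 1)).choose m : ℝ) ≤ Real.exp 1 * (Real.exp 1 * r) ^ m * K.choose m := by
  have hup := Nat.choose_le_pow_div (α := ℝ) m (r * (K + 1))
  have hlow := div_pow_le_choose K m hm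
  have hfac : ((m : ℝ) + 1) ^ m / m.factorial ≤ Real.exp 1 * Real.exp 1 ^ m := by
    have := Real.pow_div_factorial_le_exp ((m : ℝ) + 1) (by positivity) m
    rwa [← Real.exp_nat_mul, ← Real.exp_add, show (1 : ℝ) + m * 1 = m + 1 by ring]
  calc ((r * (K + 1)).choose m : ℝ) ≤ (r * (K + 1)) ^ m / m.factorial := by exact_mod_cast hup
    _ = (((m : ℝ) + 1) ^ m / m.factorial) * (r ^ m * (((K : ℝ) + 1) / (m + 1)) ^ m) := by
        rw [div_pow, mul_pow]; field_simp
    _ ≤ (Real.exp 1 * Real.exp 1 ^ m) * (r ^ m * K.choose m) := by gcongr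
    _ = _ := by rw [mul_pow]; ring

theorem choose_pred_mul_le (a q : ℕ) (ha : 1 ≤ a) (hq : 1 ≤ q) :
    ((((a - 1) * q).choose a : ℕ) : ℝ) ≤ ((q : ℝ) - 1) * q ^ (a - 1) * Real.exp 1 ^ a := by
  obtain ⟨b, rfl⟩ : ∃ b, a = b + 1 := ⟨a - 1, by omega⟩
  obtain ⟨c, rfl⟩ : ∃ c, q = c + 1 := ⟨q - 1, by omega⟩
  have hmono : ((b + 1 - 1) * (c + 1)).choose (b + 1) ≤ ((b + 1) * (c + 1) - 1).choose (b + 1) := by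
    apply Nat.choose_le_choose
    have : (b + 1) * (c + 1) = b * (c + 1) + c + 1 := by ring
    simp only [Nat.add_sub_cancel]
    omega
  have hrec := Nat.choose_mul_succ_eq ((b + 1) * (c + 1) - 1) (b + 1)
  have e1 : (b + 1) * (c + 1) - 1 + 1 = (b + 1) * (c + 1) := Nat.sub_add_cancel (by nlinarith)
  rw [e1] at hrec
  have e2 : (b + 1) * (c + 1) - (b + 1) = (b + 1) * c := by
    rw [Nat.mul_succ]; omega
  rw [e2] at hrec
  have hrec' : ((b + 1) * (c + 1) - 1).choose (b + 1) * (c + 1) =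
      ((b + 1) * (c + 1)).choose (b + 1) * c := by
    apply Nat.eq_of_mul_eq_mul_left (Nat.succ_pos b)
    linarith
  have hup := Nat.choose_le_pow_div (α := ℝ) (b + 1) ((b + 1) * (c + 1))
  have hfac := Real.pow_div_factorial_le_exp ((b : ℝ) + 1) (by positivity) (b + 1)
  have hexp : Real.exp ((b : ℝ) + 1) = Real.exp 1 ^ (b + 1) := by
    rw [← Real.exp_nat_mul]; push_cast; ring_nf
  rw [hexp] at hfac
  have hchoose : (((b + 1) * (c + 1)).choose (b + 1) : ℝ) ≤
      (c + 1) ^ (b + 1) * Real.exp 1 ^ (b + 1) := by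
    calc _ ≤ _ := hup
      _ = ((c : ℝ) + 1) ^ (b + 1) * ((b + 1) ^ (b + 1) / (b + 1).factorial) := by
        push_cast; rw [mul_pow]; ring
      _ ≤ _ := by gcongr
  have hrec'' : (((b + 1) * (c + 1) - 1).choose (b + 1) : ℝ) * (c + 1) =
      ((b + 1) * (c + 1)).choose (b + 1) * c := by exact_mod_cast hrec'
  have hmono' : ((((b + 1 - 1) * (c + 1)).choose (b + 1) : ℕ) : ℝ) ≤
      (((b + 1) * (c + 1) - 1).choose (b + 1) : ℕ) := by exact_mod_cast hmono
  refine hmono'.trans ?_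
  have hc : (0 : ℝ) < c + 1 := by positivity
  refine le_of_mul_le_mul_right ?_ hc
  rw [hrec'']
  calc _ ≤ ((c : ℝ) + 1) ^ (b + 1) * Real.exp 1 ^ (b + 1) * c := by gcongr
    _ = _ := by push_cast; rw [add_tsub_cancel_right]; ring

theorem choose_le_div_pow_mul_choose (n r b j : ℕ) (hn : r * r ≤ n) (hj : j + b + 1 ≤ r) :
    (n.choose j : ℝ) ≤ ((r : ℝ) / n) ^ b * n.choose (j + b) := by
  induction b with
  | zero => simp
  | succ b ih =>
    have hn0 : (0 : ℝ) < n := by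
      have : 0 < r := by omega
      exact_mod_cast (Nat.mul_pos this this).trans_le hn
    have hle : j + b ≤ n := by nlinarith
    have hrec : (n.choose (j + b + 1) : ℝ) * ((j + b : ℕ) + 1) =
        n.choose (j + b) * (n - (j + b : ℕ)) := by
      have := Nat.choose_succ_right_eq n (j + b)
      rw [← Nat.cast_sub hle]; exact_mod_cast this
    have hstep : (n.choose (j + b) : ℝ) ≤ (r : ℝ) / n * n.choose (j + b + 1) := by
      rw [div_mul_eq_mul_div, le_div_iff₀ hn0]
      have h1 : ((j + b : ℕ) : ℝ) + 2 ≤ r := by exact_mod_cast (by omega : j + b + 2 ≤ r)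
      have h2 : (r : ℝ) * r ≤ n := by exact_mod_cast hn
      have h0 : (0 : ℝ) ≤ (j + b : ℕ) := Nat.cast_nonneg _
      generalize ((j + b : ℕ) : ℝ) = x at *
      refine le_of_mul_le_mul_right ?_ (by linarith : 0 < x + 1)
      rw [mul_assoc (r : ℝ), hrec]
      have hc : (0 : ℝ) ≤ n.choose (j + b) := Nat.cast_nonneg _
      have key : (n : ℝ) * (x + 1) ≤ r * (n - x) := by nlinarith
      nlinarith [mul_le_mul_of_nonneg_left key hc]
    calc (n.choose j : ℝ) ≤ ((r : ℝ) / n) ^ b * n.choose (j + b) := ih (by omega)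
      _ ≤ ((r : ℝ) / n) ^ b * ((r : ℝ) / n * n.choose (j + b + 1)) := by gcongr
      _ = _ := by rw [pow_succ, ← add_assoc]; ring

theorem one_sub_mul_choose_le (n d b : ℕ) (hd : d ≤ n) (hn : 0 < n) :
    (1 - (d : ℝ) * b / n) * n.choose b ≤ (n - d).choose b := by
  rcases b with _ | b
  · simp
  have hind : n.choose (b + 1) ≤ (n - d).choose (b + 1) + d * (n - 1).choose b := by
    induction d with
    | zero => simp
    | succ d ih =>
      have := ih (by omega)
      have hs : (n - d).choose (b + 1) = (n - (d + 1)).choose b + (n - (d + 1)).choose (b + 1) := by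
        rw [show n - d = n - (d + 1) + 1 by omega, Nat.choose_succ_succ]
      have hm : (n - (d + 1)).choose b ≤ (n - 1).choose b := Nat.choose_le_choose _ (by omega)
      rw [add_mul]; omega
  have hrec : (n : ℝ) * (n - 1).choose b = n.choose (b + 1) * (b + 1) := by
    obtain ⟨N, rfl⟩ : ∃ N, n = N + 1 := ⟨n - 1, by omega⟩
    exact_mod_cast Nat.add_one_mul_choose_eq N b
  have hind' : (n.choose (b + 1) : ℝ) ≤ (n - d).choose (b + 1) + d * (n - 1).choose b := by
    exact_mod_cast hind
  have hn' : (0 : ℝ) < n := by exact_mod_cast hn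
  have : ((n - 1).choose b : ℝ) = n.choose (b + 1) * (b + 1) / n := by
    field_simp; linarith
  rw [this] at hind'
  push_cast
  have e : (1 - (d : ℝ) * (b + 1) / n) * n.choose (b + 1) =
    n.choose (b + 1) - d * (n.choose (b + 1) * (b + 1) / n) := by ring
  rw [e]; linarith

theorem mul_choose_le_choose_sub_choose (h q m : ℕ) (hq : 1 ≤ q) (hk : 2 ≤ h + q) :
    (q - 1) * (h + q - 2).choose m ≤
      (m + 1) * ((h + q - 1).choose (m + 1) - h.choose (m + 1)) := by
  have h1 := Nat.add_one_mul_choose_eq (h + q - 2) m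
  rw [show h + q - 2 + 1 = h + q - 1 by omega] at h1
  have h2 : (m + 1) * h.choose (m + 1) ≤ h * (h + q - 2).choose m := by
    rcases h with _ | h
    · simp
    have := Nat.add_one_mul_choose_eq h m
    rw [mul_comm, ← this]
    exact Nat.mul_le_mul_left _ (Nat.choose_le_choose _ (by omega))
  rw [Nat.mul_sub, mul_comm (m + 1) ((h + q - 1).choose _), ← h1,
    show h + q - 1 = (q - 1) + h by omega, add_mul]
  omega

set_option maxHeartbeats 1000000 in
/-- For large `n`, the cliques that avoid the extremal configuration are outnumbered by the
extremal cliques that are missing. -/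
theorem sum_choose_mul_le (n h q m r : ℕ) (hr : 1 ≤ r) (hq : 1 ≤ q) (hm : m + 2 ≤ h + q)
    (hn : 4 * ((h + q : ℕ) : ℝ) * ((m : ℝ) + 2) * (Real.exp 1 * r) ^ (m + 2) ≤ n) :
    ∑ a ∈ Icc 2 r, (h + a * q - 1 - a).choose m * ((a - 1) * q).choose a * n.choose (r - a) ≤
      ((h + q - 1).choose (m + 1) - h.choose (m + 1)) * (n - r * (h + q)).choose (r - 1) := by
  rcases hr.eq_or_lt with rfl | hr2
  · simp
  have he1 : (2.7 : ℝ) < Real.exp 1 := by linarith [Real.exp_one_gt_d9]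
  have he2 : Real.exp 1 < 2.72 := by linarith [Real.exp_one_lt_d9]
  have hrR : (2 : ℝ) ≤ r := by exact_mod_cast hr2
  have hqk : (q : ℝ) ≤ (h + q : ℕ) := by exact_mod_cast Nat.le_add_left q h
  have hq1 : (1 : ℝ) ≤ q := by exact_mod_cast hq
  have hk2 : (2 : ℝ) ≤ (h + q : ℕ) := by exact_mod_cast (by omega : 2 ≤ h + q)
  set k : ℝ := ((h + q : ℕ) : ℝ) with hk
  set e := Real.exp 1 with he
  have her : 1 ≤ e * r := by nlinarith
  have hP : 1 ≤ (e * r) ^ m := one_le_pow₀ her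
  have hm0 : (0 : ℝ) ≤ m := Nat.cast_nonneg m
  have hbig : 32 * k * r * r ≤ (n : ℝ) := by
    refine le_trans ?_ hn
    have h1 : (4 : ℝ) * r * r ≤ (e * r) ^ (m + 2) := by
      rw [pow_add]
      have h4 : (4 : ℝ) ≤ e ^ 2 := by nlinarith
      have : (4 : ℝ) * r * r ≤ (e * r) ^ 2 := by
        rw [mul_pow, sq (r : ℝ), mul_assoc]
        gcongr
      nlinarith [sq_nonneg (e * r)]
    have h2 : 32 * k * r * r ≤ 4 * k * 2 * (4 * r * r) := le_of_eq (by ring)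
    refine h2.trans ?_
    gcongr
    linarith
  have hn0 : (0 : ℝ) < n := lt_of_lt_of_le (by positivity) hbig
  have hrr : r * r ≤ n := by
    have : (r : ℝ) * r ≤ n := by
      nlinarith [mul_pos (by linarith : (0 : ℝ) < r) (by linarith : (0 : ℝ) < r)]
    exact_mod_cast this
  have hrk : r * (h + q) ≤ n := by
    have : (r : ℝ) * k ≤ n := by
      nlinarith [mul_pos (by linarith : (0 : ℝ) < k) (by linarith : (0 : ℝ) < r)]
    rw [hk] at this
    exact_mod_cast this
  set N : ℝ := ((n.choose (r - 1) : ℕ) : ℝ) with hN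
  set C : ℝ := (((h + q - 2).choose m : ℕ) : ℝ) with hC
  have hC0 : 0 ≤ C := Nat.cast_nonneg _
  have hN0 : 0 ≤ N := Nat.cast_nonneg _
  set y : ℝ := e * q * (r / n) with hy
  have hy0 : 0 ≤ y := by positivity
  have hyP : y * (4 * (m + 2) * (e * r) ^ (m + 1)) ≤ 1 := by
    have : e * q * r * (4 * (m + 2) * (e * r) ^ (m + 1)) ≤ n := by
      refine le_trans ?_ hn
      calc _ = 4 * (q : ℝ) * (m + 2) * (e * r) ^ (m + 2) := by ring
        _ ≤ _ := by gcongr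
    calc _ = e * q * r * (4 * (m + 2) * (e * r) ^ (m + 1)) / n := by rw [hy]; ring
      _ ≤ 1 := by rwa [div_le_one hn0]
  have hyhalf : y ≤ 1 / 2 := by
    have h1 : 1 ≤ (e * r) ^ (m + 1) := one_le_pow₀ her
    have h2 : (2 : ℝ) ≤ 4 * (m + 2) * (e * r) ^ (m + 1) := by nlinarith
    nlinarith
  have hterm : ∀ a ∈ Icc 2 r,
      (((h + a * q - 1 - a).choose m * ((a - 1) * q).choose a * n.choose (r - a) : ℕ) : ℝ) ≤
        (q - 1) * C * N * (e ^ 2 * (e * r) ^ m) * y ^ (a - 1) := by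
    intro a ha
    rw [mem_Icc] at ha
    have h1 : ((h + a * q - 1 - a).choose m : ℝ) ≤ e * (e * r) ^ m * C := by
      refine le_trans ?_ (choose_mul_le_exp_mul r (h + q - 2) m (by omega))
      have hle : h + a * q - 1 - a ≤ r * (h + q - 2 + 1) := by
        obtain ⟨c, rfl⟩ : ∃ c, q = c + 1 := ⟨q - 1, by omega⟩
        have : a * (h + c) ≤ r * (h + c) := Nat.mul_le_mul_right _ ha.2
        have h3 : h ≤ a * h := Nat.le_mul_of_pos_left h (by omega)
        rw [show h + (c + 1) - 2 + 1 = h + c by omega]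
        rw [mul_add] at this
        rw [mul_add, mul_one]
        omega
      exact_mod_cast Nat.choose_le_choose m hle
    have h2 := choose_pred_mul_le a q (by omega) hq
    have h3 : (n.choose (r - a) : ℝ) ≤ ((r : ℝ) / n) ^ (a - 1) * N := by
      have := choose_le_div_pow_mul_choose n r (a - 1) (r - a) hrr (by omega)
      rwa [show r - a + (a - 1) = r - 1 by omega] at this
    have hq0 : (0 : ℝ) ≤ q - 1 := by linarith
    push_cast
    calc _ ≤ (e * (e * r) ^ m * C) * (((q : ℝ) - 1) * q ^ (a - 1) * e ^ a) *
          (((r : ℝ) / n) ^ (a - 1) * N) := by gcongr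
      _ = _ := by
        obtain ⟨b, rfl⟩ : ∃ b, a = b + 1 := ⟨a - 1, by omega⟩
        rw [hy, Nat.add_sub_cancel, mul_pow, mul_pow]; ring
  have hgeom : ∑ a ∈ Icc 2 r, y ^ (a - 1) ≤ 2 * y := by
    have hre : ∑ a ∈ Icc 2 r, y ^ (a - 1) = y * ∑ i ∈ range (r - 1), y ^ i := by
      rw [mul_sum]
      refine sum_nbij' (fun a => a - 2) (fun i => i + 2) ?_ ?_ ?_ ?_ ?_ <;>
        simp only [mem_Icc, mem_range]
      · intro a ha; omega
      · intro a ha; omega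
      · intro a ha; omega
      · intro a ha; omega
      · intro a ha
        rw [← pow_succ', show a - 2 + 1 = a - 1 by omega]
    have hg := geom_sum_mul_neg y (r - 1)
    have hpow : 0 ≤ y ^ (r - 1) := by positivity
    have hs0 : 0 ≤ ∑ i ∈ range (r - 1), y ^ i := by positivity
    have : ∑ i ∈ range (r - 1), y ^ i ≤ 2 := by nlinarith
    rw [hre]; nlinarith
  have hlow : 3 / 4 * N ≤ (n - r * (h + q)).choose (r - 1) := by
    refine le_trans ?_ (one_sub_mul_choose_le n (r * (h + q)) (r - 1) hrk (by exact_mod_cast hn0))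
    have : ((r * (h + q) : ℕ) : ℝ) * (r - 1 : ℕ) / n ≤ 1 / 4 := by
      rw [div_le_iff₀ hn0, Nat.cast_mul, Nat.cast_sub hr, ← hk]
      push_cast
      have : (0 : ℝ) ≤ r * k := by positivity
      nlinarith
    gcongr
    linarith
  have hR : ((q : ℝ) - 1) * C ≤
      (m + 1) * (((h + q - 1).choose (m + 1) - h.choose (m + 1) : ℕ) : ℝ) := by
    have := mul_choose_le_choose_sub_choose h q m hq (by omega)
    have h' : (((q - 1 : ℕ) : ℝ)) * C ≤
      (m + 1) * (((h + q - 1).choose (m + 1) - h.choose (m + 1) : ℕ) : ℝ) := by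
      rw [hC]; exact_mod_cast this
    rwa [Nat.cast_sub hq, Nat.cast_one] at h'
  have hconst : e ^ 2 * (e * r) ^ m * (2 * y) * (m + 1) ≤ 3 / 4 := by
    have h1 : y * (e * r) ^ m * (4 * (m + 2) * (e * r)) ≤ 1 := by
      refine le_trans (le_of_eq ?_) hyP; ring
    set z := y * (e * r) ^ m with hz
    have hz0 : 0 ≤ z := by positivity
    have h2 : z * (m + 1) * (8 * e) ≤ 1 := by
      refine le_trans ?_ h1
      have : (m + 1) * (8 * e) ≤ 4 * (m + 2) * (e * r) := by
        have : (m + 1) * (e * 2) ≤ (m + 2) * (e * r) := by gcongr; linarith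
        linarith
      calc _ = z * ((m + 1) * (8 * e)) := by ring
        _ ≤ _ := by gcongr
    calc _ = (z * (m + 1) * (8 * e)) * (e / 4) := by rw [hz]; ring
      _ ≤ 1 * (e / 4) := by gcongr
      _ ≤ 3 / 4 := by linarith
  have hQ0 : 0 ≤ ((q : ℝ) - 1) * C * N := mul_nonneg (mul_nonneg (by linarith) hC0) hN0
  have hfinal : ((∑ a ∈ Icc 2 r,
      (h + a * q - 1 - a).choose m * ((a - 1) * q).choose a * n.choose (r - a) : ℕ) : ℝ) ≤
      ((((h + q - 1).choose (m + 1) - h.choose (m + 1)) *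
        (n - r * (h + q)).choose (r - 1) : ℕ) : ℝ) := by
    rw [Nat.cast_sum]
    set R : ℝ := (((h + q - 1).choose (m + 1) - h.choose (m + 1) : ℕ) : ℝ) with hRdef
    calc _ ≤ ∑ a ∈ Icc 2 r, (q - 1) * C * N * (e ^ 2 * (e * r) ^ m) * y ^ (a - 1) :=
          sum_le_sum hterm
      _ = (q - 1) * C * N * (e ^ 2 * (e * r) ^ m) * ∑ a ∈ Icc 2 r, y ^ (a - 1) := by rw [mul_sum]
      _ ≤ (q - 1) * C * N * (e ^ 2 * (e * r) ^ m) * (2 * y) := by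
          gcongr
      _ = ((q - 1) * C) * (N * (e ^ 2 * (e * r) ^ m * (2 * y))) := by ring
      _ ≤ ((m + 1) * R) * (N * (e ^ 2 * (e * r) ^ m * (2 * y))) := by gcongr
      _ = R * N * (e ^ 2 * (e * r) ^ m * (2 * y) * (m + 1)) := by ring
      _ ≤ R * N * (3 / 4) := by gcongr
      _ = R * (3 / 4 * N) := by ring
      _ ≤ R * (n - r * (h + q)).choose (r - 1) := by gcongr
      _ = _ := by rw [hRdef, Nat.cast_mul]
  exact_mod_cast hfinal

/-- The edge `E` with `j` replaced by `i`, if this is possible and gives a set outside `H`. -/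
def pushEdge {α : Type*} [DecidableEq α] (H : Finset (Finset α)) (i j : α) (E : Finset α) :
    Finset α :=
  if j ∈ E ∧ i ∉ E ∧ insert i (E.erase j) ∉ H then insert i (E.erase j) else E

/-- The family `H` with `j` replaced by `i` in its edges wherever possible. -/
def pushFamily {α : Type*} [DecidableEq α] (H : Finset (Finset α)) (i j : α) :
    Finset (Finset α) :=
  H.image (pushEdge H i j)

/-- The `s`-cliques with vertices below `n` of the `r`-uniform hypergraph `H`. -/
def cliquesBelow (n r s : ℕ) (H : Finset (Finset ℕ)) : Finset (Finset ℕ) :=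
  ((range n).powersetCard s).filter fun S => S.powersetCard r ⊆ H

/-- The family `H` is closed under replacing a vertex of an edge by a smaller one. -/
def IsLeftClosed (H : Finset (Finset ℕ)) : Prop :=
  ∀ i j, i < j → ∀ E ∈ H, j ∈ E → i ∉ E → insert i (E.erase j) ∈ H

/-- A choice of pairwise disjoint edges, one from each family. -/
def HasRainbowMatching {ι α : Type*} (F : ι → Finset (Finset α)) : Prop :=
  ∃ e : ι → Finset α, (∀ x, e x ∈ F x) ∧ ∀ x y, x ≠ y → Disjoint (e x) (e y)

theorem insert_erase_insert_erase {α : Type*} [DecidableEq α] {i j : α} {E : Finset α}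
    (hj : j ∈ E) (hi : i ∉ E) : insert j ((insert i (E.erase j)).erase i) = E := by
  ext x; simp only [mem_insert, mem_erase]; grind

theorem mem_pushFamily {α : Type*} [DecidableEq α] {H : Finset (Finset α)} {i j : α}
    {E : Finset α} (hij : i ≠ j) : E ∈ pushFamily H i j ↔
      (E ∈ H ∧ (j ∈ E → i ∉ E → insert i (E.erase j) ∈ H)) ∨
      (E ∉ H ∧ i ∈ E ∧ j ∉ E ∧ insert j (E.erase i) ∈ H) := by
  unfold pushFamily pushEdge
  rw [mem_image]
  constructor
  · rintro ⟨G, hG, rfl⟩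
    split_ifs with h
    · refine Or.inr ⟨h.2.2, mem_insert_self _ _, by simp [hij.symm], ?_⟩
      rwa [insert_erase_insert_erase h.1 h.2.1]
    · exact Or.inl ⟨hG, by tauto⟩
  · rintro (⟨hE, h⟩ | ⟨hE, hi, hj, h⟩)
    · exact ⟨E, hE, if_neg (by tauto)⟩
    · have key := insert_erase_insert_erase hi hj
      refine ⟨_, h, ?_⟩
      rw [key, if_pos ⟨mem_insert_self _ _, by simp [hij], hE⟩]

theorem pushEdge_injOn {α : Type*} [DecidableEq α] (H : Finset (Finset α)) (i j : α) :
    Set.InjOn (pushEdge H i j) H := by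
  intro A hA B hB h
  unfold pushEdge at h
  split_ifs at h with h1 h2 h2
  · rw [← insert_erase_insert_erase h1.1 h1.2.1, h, insert_erase_insert_erase h2.1 h2.2.1]
  · exact absurd (h ▸ hB) h1.2.2
  · exact absurd (h ▸ hA) h2.2.2
  · exact h

theorem card_insert_erase {α : Type*} [DecidableEq α] {i j : α} {E : Finset α}
    (hj : j ∈ E) (hi : i ∉ E) : #(insert i (E.erase j)) = #E := by
  rw [card_insert_of_notMem (by simp [hi]), card_erase_add_one hj]

theorem card_of_mem_pushFamily {α : Type*} [DecidableEq α] {H : Finset (Finset α)} {i j : α}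
    {r : ℕ} (hH : ∀ E ∈ H, #E = r) : ∀ E ∈ pushFamily H i j, #E = r := by
  intro E hE
  obtain ⟨G, hG, rfl⟩ := mem_image.1 hE
  unfold pushEdge
  split_ifs with h
  · rw [card_insert_erase h.1 h.2.1, hH G hG]
  · exact hH G hG

theorem pushFamily_cliquesBelow_subset {n r s i j : ℕ} (hij : i < j) (H : Finset (Finset ℕ)) :
    pushFamily (cliquesBelow n r s H) i j ⊆ cliquesBelow n r s (pushFamily H i j) := by
  intro S hS
  rw [mem_pushFamily hij.ne] at hS
  simp only [cliquesBelow, mem_filter, mem_powersetCard] at hS ⊢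
  rcases hS with ⟨⟨⟨hSn, hSs⟩, hcl⟩, hpush⟩ | ⟨hnot, hi, hj, ⟨hTn, hTs⟩, hcl⟩
  · refine ⟨⟨hSn, hSs⟩, fun E hE => ?_⟩
    rw [mem_pushFamily hij.ne]
    refine Or.inl ⟨hcl hE, fun hjE hiE => ?_⟩
    rw [mem_powersetCard] at hE
    have hcard : #(insert i (E.erase j)) = r := by rw [card_insert_erase hjE hiE, hE.2]
    by_cases hiS : i ∈ S
    · refine hcl (mem_powersetCard.2 ⟨insert_subset hiS ?_, hcard⟩)
      exact (erase_subset _ _).trans hE.1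
    · refine (hpush (hE.1 hjE) hiS).2 (mem_powersetCard.2 ⟨?_, hcard⟩)
      exact insert_subset_insert _ (erase_subset_erase _ hE.1)
  · have hjn : j < n := mem_range.1 (hTn (mem_insert_self _ _))
    refine ⟨⟨fun x hx => ?_, ?_⟩, fun E hE => ?_⟩
    · by_cases hxi : x = i
      · exact mem_range.2 (by omega)
      · exact hTn (mem_insert_of_mem (mem_erase.2 ⟨hxi, hx⟩))
    · rwa [card_insert_erase hi hj] at hTs
    · rw [mem_powersetCard] at hE
      rw [mem_pushFamily hij.ne]
      have hjE : j ∉ E := fun h => hj (hE.1 h)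
      by_cases hiE : i ∈ E
      · have hG : insert j (E.erase i) ∈ H := by
          refine hcl (mem_powersetCard.2 ⟨?_, by rw [card_insert_erase hiE hjE, hE.2]⟩)
          exact insert_subset_insert _ (erase_subset_erase _ hE.1)
        by_cases hEH : E ∈ H
        · exact Or.inl ⟨hEH, fun h => absurd h hjE⟩
        · exact Or.inr ⟨hEH, hiE, hjE, hG⟩
      · refine Or.inl ⟨hcl (mem_powersetCard.2 ⟨?_, hE.2⟩), fun h => absurd h hjE⟩
        intro x hx
        exact mem_insert_of_mem (mem_erase.2 ⟨fun h => hiE (h ▸ hx), hE.1 hx⟩)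

theorem card_cliquesBelow_le_pushFamily {n r s i j : ℕ} (hij : i < j) (H : Finset (Finset ℕ)) :
    #(cliquesBelow n r s H) ≤ #(cliquesBelow n r s (pushFamily H i j)) := by
  rw [← card_image_of_injOn (pushEdge_injOn (cliquesBelow n r s H) i j)]
  exact card_le_card (pushFamily_cliquesBelow_subset hij H)

theorem HasRainbowMatching.of_pushFamily {ι α : Type*} [DecidableEq α]
    {F : ι → Finset (Finset α)} {i j : α} (hij : i ≠ j)
    (h : HasRainbowMatching fun x => pushFamily (F x) i j) : HasRainbowMatching F := by
  obtain ⟨e, he, hdis⟩ := h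
  by_cases hall : ∀ x, e x ∈ F x
  · exact ⟨e, hall, hdis⟩
  push Not at hall
  obtain ⟨l, hl⟩ := hall
  simp only [mem_pushFamily hij] at he
  have hl' : i ∈ e l ∧ j ∉ e l ∧ insert j ((e l).erase i) ∈ F l := by
    rcases he l with h | h
    · exact absurd h.1 hl
    · exact h.2
  refine ⟨fun x => (e x).map (Equiv.swap i j).toEmbedding, fun x => ?_, fun x y hxy => ?_⟩
  · dsimp only
    rcases eq_or_ne x l with rfl | hxl
    · convert hl'.2.2 using 1
      ext v
      simp only [mem_map_equiv, mem_insert, mem_erase, Equiv.symm_swap, Equiv.swap_apply_def]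
      grind
    · have hix : i ∉ e x := disjoint_left.1 (hdis l x hxl.symm) hl'.1
      have hx : e x ∈ F x ∧ (j ∈ e x → i ∉ e x → insert i ((e x).erase j) ∈ F x) := by
        rcases he x with h | h
        · exact h
        · exact absurd h.2.1 hix
      by_cases hjx : j ∈ e x
      · convert hx.2 hjx hix using 1
        ext v
        simp only [mem_map_equiv, mem_insert, mem_erase, Equiv.symm_swap, Equiv.swap_apply_def]
        grind
      · convert hx.1 using 1
        ext v
        simp only [mem_map_equiv, Equiv.symm_swap, Equiv.swap_apply_def]
        grind
  · exact (disjoint_map _).2 (hdis x y hxy)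

theorem sum_pushEdge_le {i j : ℕ} (hij : i < j) (H : Finset (Finset ℕ)) (E : Finset ℕ) :
    ∑ v ∈ pushEdge H i j E, v ≤ ∑ v ∈ E, v := by
  unfold pushEdge
  split_ifs with h
  · rw [sum_insert (by simp [h.2.1]), ← add_sum_erase E _ h.1]
    omega
  · exact le_rfl

theorem sum_pushFamily_le {i j : ℕ} (hij : i < j) (H : Finset (Finset ℕ)) :
    ∑ E ∈ pushFamily H i j, ∑ v ∈ E, v ≤ ∑ E ∈ H, ∑ v ∈ E, v := by
  rw [pushFamily, sum_image (pushEdge_injOn H i j)]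
  exact sum_le_sum fun E _ => sum_pushEdge_le hij H E

theorem sum_pushFamily_lt {i j : ℕ} (hij : i < j) {H : Finset (Finset ℕ)} {E : Finset ℕ}
    (hE : E ∈ H) (hj : j ∈ E) (hi : i ∉ E) (hEH : insert i (E.erase j) ∉ H) :
    ∑ E ∈ pushFamily H i j, ∑ v ∈ E, v < ∑ E ∈ H, ∑ v ∈ E, v := by
  rw [pushFamily, sum_image (pushEdge_injOn H i j)]
  refine sum_lt_sum (fun E _ => sum_pushEdge_le hij H E) ⟨E, hE, ?_⟩
  rw [pushEdge, if_pos ⟨hj, hi, hEH⟩, sum_insert (by simp [hi]), ← add_sum_erase E _ hj]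
  omega

/-- Repeated pushing makes all families left-closed without losing cliques or creating a
rainbow matching. -/
theorem exists_isLeftClosed {ι : Type*} [Fintype ι] (n r : ℕ) (F : ι → Finset (Finset ℕ))
    (hF : ∀ x, ∀ E ∈ F x, #E = r) :
    ∃ G : ι → Finset (Finset ℕ), (∀ x, IsLeftClosed (G x)) ∧ (∀ x, ∀ E ∈ G x, #E = r) ∧
      (∀ x s, #(cliquesBelow n r s (F x)) ≤ #(cliquesBelow n r s (G x))) ∧
      (HasRainbowMatching G → HasRainbowMatching F) := by
  induction hN : ∑ x, ∑ E ∈ F x, ∑ v ∈ E, v using Nat.strong_induction_on generalizing F with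
  | _ N ih =>
    subst hN
    by_cases hcl : ∀ x, IsLeftClosed (F x)
    · exact ⟨F, hcl, hF, fun _ _ => le_rfl, id⟩
    unfold IsLeftClosed at hcl
    push Not at hcl
    obtain ⟨x, i, j, hij, E, hE, hj, hi, hEx⟩ := hcl
    obtain ⟨G, hG, hGr, hGc, hGm⟩ := ih _
      (sum_lt_sum (fun y _ => sum_pushFamily_le hij (F y))
        ⟨x, mem_univ x, sum_pushFamily_lt hij hE hj hi hEx⟩)
      (fun y => pushFamily (F y) i j) (fun y => card_of_mem_pushFamily (hF y)) rfl
    exact ⟨G, hG, hGr, fun y s => (card_cliquesBelow_le_pushFamily hij (F y)).trans (hGc y s),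
      fun h => (hGm h).of_pushFamily hij.ne⟩

/-- A left-closed family contains every set dominated by one of its edges. -/
theorem IsLeftClosed.mem_of_dominated {H : Finset (Finset ℕ)} (hH : IsLeftClosed H)
    {e f : Finset ℕ} (he : e ∈ H) (hcard : #e = #f)
    (hdom : ∀ u, #(e.filter (· < u)) ≤ #(f.filter (· < u))) : f ∈ H := by
  induction hN : #(e \ f) generalizing e with
  | zero =>
    rw [card_eq_zero, sdiff_eq_empty_iff_subset] at hN
    rwa [← eq_of_subset_of_card_le hN hcard.ge]
  | succ N ih =>
    have hne : (e \ f).Nonempty := card_pos.1 (by omega)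
    obtain ⟨j, hj, hmin⟩ := exists_min_image (e \ f) id hne
    rw [mem_sdiff] at hj
    obtain ⟨i, hif, hie, hij⟩ : ∃ i ∈ f, i ∉ e ∧ i < j := by
      by_contra! hcon
      have hsub : f.filter (· < j + 1) ⊂ e.filter (· < j + 1) := by
        rw [ssubset_iff_of_subset]
        · exact ⟨j, by simp [hj.1], by simp [hj.2]⟩
        · intro v hv
          rw [mem_filter] at hv ⊢
          refine ⟨?_, hv.2⟩
          by_contra hve
          have := hcon v hv.1 hve
          exact hj.2 ((by omega : v = j) ▸ hv.1)
      exact absurd (hdom (j + 1)) (not_le.2 (card_lt_card hsub))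
    refine ih (hH i j hij e he hj.1 hie) (by rw [card_insert_erase hj.1 hie, hcard]) ?_ ?_
    · intro u
      by_cases hiu : i < u
      · by_cases hju : j < u
        · refine le_trans (le_of_eq ?_) (hdom u)
          have : (insert i (e.erase j)).filter (· < u) =
              insert i ((e.filter (· < u)).erase j) := by
            rw [filter_insert, if_pos hiu, filter_erase]
          rw [this, card_insert_erase (by simp [hj.1, hju]) (by simp [hie])]
        · apply card_le_card
          intro v hv
          rw [mem_filter, mem_insert, mem_erase] at hv
          rw [mem_filter]
          refine ⟨?_, hv.2⟩
          rcases hv.1 with rfl | hve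
          · exact hif
          · by_contra hvf
            have : j ≤ v := hmin v (mem_sdiff.2 ⟨hve.2, hvf⟩)
            omega
      · refine le_trans (card_le_card ?_) (hdom u)
        intro v hv
        simp only [mem_filter, mem_insert, mem_erase] at hv ⊢
        rcases hv.1 with rfl | hve
        · omega
        · exact ⟨hve.2, hv.2⟩
    · have : insert i (e.erase j) \ f = (e \ f).erase j := by
        rw [insert_sdiff_of_mem _ hif, erase_sdiff_comm]
      rw [this, card_erase_of_mem (mem_sdiff.2 hj), hN]
      omega

theorem exists_injOn_lt_card {α : Type*} [DecidableEq α] (I : Finset α) :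
    ∃ φ : α → ℕ, (∀ i ∈ I, φ i < #I) ∧ Set.InjOn φ I := by
  refine ⟨fun i => if hi : i ∈ I then I.equivFin ⟨i, hi⟩ else 0, fun i hi => ?_,
    fun i hi j hj hij => ?_⟩
  · simp [hi]
  · rw [mem_coe] at hi hj
    simpa [hi, hj, Fin.val_inj] using hij

/-- The arithmetic progression of length `r` and difference `q` starting at `h + l`. -/
def lightEdge (h q r l : ℕ) : Finset ℕ := (range r).image fun b => h + l + b * q

/-- The vertex `x` together with `r - 1` private vertices beyond all light edges. -/
def heavyEdge (h q r x : ℕ) : Finset ℕ :=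
  insert x (Ico (h + r * q + x * (r - 1)) (h + r * q + (x + 1) * (r - 1)))

theorem lightEdge_mem {H : Finset (Finset ℕ)} (hH : IsLeftClosed H) {h q r l : ℕ} (hl : l < q)
    {e : Finset ℕ} (he : e ∈ H) (hr : #e = r)
    (hlow : ∀ a, 1 ≤ a → a ≤ r → #(e.filter (· < h + a * q - 1)) < a) :
    lightEdge h q r l ∈ H := by
  have hinj : Function.Injective fun b => h + l + b * q := fun b c hbc => by
    have hbc' : b * q = c * q := by simpa using hbc
    exact Nat.eq_of_mul_eq_mul_right (by omega) hbc'
  refine hH.mem_of_dominated he ?_ fun u => ?_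
  · rw [lightEdge, card_image_of_injective _ hinj, card_range, hr]
  · obtain ⟨m, hm⟩ : ∃ m, m = #(e.filter (· < u)) := ⟨_, rfl⟩
    have hmr : m ≤ r := by rw [hm, ← hr]; exact card_filter_le _ _
    rw [← hm]
    rcases Nat.eq_zero_or_pos m with h0 | hpos
    · omega
    have hu : h + m * q ≤ u := by
      by_contra! hlt
      have := hlow m hpos hmr
      have hle : #(e.filter (· < u)) ≤ #(e.filter (· < h + m * q - 1)) :=
        card_le_card (monotone_filter_right _ fun v _ hv => by omega)
      omega
    rw [← card_range m, ← card_image_of_injective (range m) hinj]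
    refine card_le_card fun v hv => ?_
    obtain ⟨b, hb, rfl⟩ := mem_image.1 hv
    rw [mem_range] at hb
    refine mem_filter.2 ⟨mem_image_of_mem _ (mem_range.2 (by omega)), ?_⟩
    have : (b + 1) * q ≤ m * q := Nat.mul_le_mul_right _ hb
    rw [add_mul] at this
    omega

theorem heavyEdge_mem {H : Finset (Finset ℕ)} (hH : IsLeftClosed H) {h q r x : ℕ} (hx : x < h)
    (hr0 : 1 ≤ r) {e : Finset ℕ} (he : e ∈ H) (hr : #e = r) (hxe : ∀ v ∈ e, x ≤ v)
    (hlow : #(e.filter (· < r * (h + q))) ≤ 1) : heavyEdge h q r x ∈ H := by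
  have hxr : (x + 1) * (r - 1) ≤ h * (r - 1) := Nat.mul_le_mul_right _ hx
  have hhr : h * (r - 1) + h = r * h := by
    obtain ⟨p, rfl⟩ : ∃ p, r = p + 1 := ⟨r - 1, by omega⟩
    rw [Nat.add_sub_cancel]; ring
  have hcard : #(heavyEdge h q r x) = r := by
    rw [heavyEdge, card_insert_of_notMem, Nat.card_Ico, add_mul]
    · omega
    · rw [mem_Ico]; omega
  refine hH.mem_of_dominated he (by rw [hcard, hr]) fun u => ?_
  rcases le_or_gt u x with hux | hux
  · rw [filter_eq_empty_iff.2 fun v hv => by have := hxe v hv; omega]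
    simp
  rcases le_or_gt u (r * (h + q)) with hur | hur
  · refine le_trans ((card_le_card (monotone_filter_right _ fun v _ hv => by omega)).trans hlow) ?_
    exact card_pos.2 ⟨x, mem_filter.2 ⟨mem_insert_self _ _, hux⟩⟩
  · rw [filter_true_of_mem (s := heavyEdge h q r x), hcard, ← hr]
    · exact card_filter_le _ _
    · intro v hv
      rw [heavyEdge, mem_insert, mem_Ico] at hv
      rw [mul_add] at hur
      omega

theorem disjoint_lightEdge {h q r l l' : ℕ} (hl : l < q) (hl' : l' < q) (hne : l ≠ l') :
    Disjoint (lightEdge h q r l) (lightEdge h q r l') := by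
  rw [disjoint_left]
  intro v hv hv'
  obtain ⟨b, -, rfl⟩ := mem_image.1 hv
  obtain ⟨c, -, hc⟩ := mem_image.1 hv'
  have hmod : (l' + c * q) % q = (l + b * q) % q := by congr 1; omega
  rw [Nat.add_mul_mod_self_right, Nat.add_mul_mod_self_right, Nat.mod_eq_of_lt hl,
    Nat.mod_eq_of_lt hl'] at hmod
  exact hne hmod.symm

theorem disjoint_heavyEdge_lightEdge {h q r x l : ℕ} (hx : x < h) (hl : l < q) :
    Disjoint (heavyEdge h q r x) (lightEdge h q r l) := by
  rw [disjoint_left]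
  intro v hv hv'
  obtain ⟨b, hb, rfl⟩ := mem_image.1 hv'
  rw [heavyEdge, mem_insert, mem_Ico] at hv
  have : (b + 1) * q ≤ r * q := Nat.mul_le_mul_right _ (mem_range.1 hb)
  rw [add_mul] at this
  omega

theorem disjoint_heavyEdge {h q r x y : ℕ} (hx : x < h) (hy : y < h) (hne : x ≠ y) :
    Disjoint (heavyEdge h q r x) (heavyEdge h q r y) := by
  rw [disjoint_left]
  intro v hv hv'
  rw [heavyEdge, mem_insert, mem_Ico] at hv hv'
  have h1 : x < y → (x + 1) * (r - 1) ≤ y * (r - 1) := fun h => Nat.mul_le_mul_right _ h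
  have h2 : y < x → (y + 1) * (r - 1) ≤ x * (r - 1) := fun h => Nat.mul_le_mul_right _ h
  omega

theorem hasRainbowMatching_of_heavy_light {k h q r : ℕ} (hr : 1 ≤ r)
    {G : Fin k → Finset (Finset ℕ)} (hcl : ∀ i, IsLeftClosed (G i))
    (hG : ∀ i, ∀ E ∈ G i, #E = r) (hk : h + q = k) (I : Finset (Fin k)) (hI : #I = h)
    (hheavy : ∀ i ∈ I, ∃ e ∈ G i, (∀ v ∈ e, h - 1 ≤ v) ∧ #(e.filter (· < r * k)) ≤ 1)
    (hlight : ∀ i ∉ I, ∃ e ∈ G i, ∀ a, 1 ≤ a → a ≤ r → #(e.filter (· < h + a * q - 1)) < a) :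
    HasRainbowMatching G := by
  obtain ⟨φ, hφ, hφi⟩ := exists_injOn_lt_card I
  obtain ⟨ψ, hψ, hψi⟩ := exists_injOn_lt_card Iᶜ
  have hIc : #Iᶜ = q := by rw [card_compl, hI, Fintype.card_fin]; omega
  rw [hI] at hφ
  rw [hIc] at hψ
  simp only [mem_compl] at hψ
  refine ⟨fun i => if i ∈ I then heavyEdge h q r (φ i) else lightEdge h q r (ψ i),
    fun i => ?_, fun i j hij => ?_⟩
  · dsimp only
    split_ifs with hi
    · obtain ⟨e, he, hev, hec⟩ := hheavy i hi
      have := hφ i hi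
      exact heavyEdge_mem (hcl i) this hr he (hG i e he)
        (fun v hv => by have := hev v hv; omega) (by rwa [hk])
    · obtain ⟨e, he, hea⟩ := hlight i hi
      exact lightEdge_mem (hcl i) (hψ i hi) he (hG i e he) hea
  · dsimp only
    split_ifs with hi hj hj
    · exact disjoint_heavyEdge (hφ i hi) (hφ j hj) fun h => hij (hφi hi hj h)
    · exact disjoint_heavyEdge_lightEdge (hφ i hi) (hψ j hj)
    · exact (disjoint_heavyEdge_lightEdge (hφ j hj) (hψ i hi)).symm
    · exact disjoint_lightEdge (hψ i hi) (hψ j hj) fun h =>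
        hij (hψi (by simpa using hi) (by simpa using hj) h)

/-- If left-closed families have no rainbow matching, one of them has few edges of small
intersection with the initial vertices. -/
theorem exists_restricted_family {k r : ℕ} (hr : 1 ≤ r)
    {G : Fin k → Finset (Finset ℕ)} (hcl : ∀ i, IsLeftClosed (G i))
    (hG : ∀ i, ∀ E ∈ G i, #E = r) (hno : ¬ HasRainbowMatching G) :
    ∃ i h q, h + q = k ∧ 1 ≤ q ∧
      (∀ e ∈ G i, (∀ v ∈ e, h ≤ v) → 2 ≤ #(e.filter (· < r * k))) ∧
      ∀ e ∈ G i, ∃ a, 1 ≤ a ∧ a ≤ r ∧ a ≤ #(e.filter (· < h + a * q - 1)) := by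
  classical
  let good : ℕ → Finset (Fin k) := fun h => univ.filter fun i =>
    ∃ e ∈ G i, (∀ v ∈ e, h ≤ v) ∧ #(e.filter (· < r * k)) ≤ 1
  have hex : ∃ h, #(good h) ≤ h := ⟨k, (card_le_univ _).trans (by simp)⟩
  obtain ⟨h, hh, hmin⟩ : ∃ h, #(good h) ≤ h ∧ ∀ h' < h, h' < #(good h') :=
    ⟨Nat.find hex, Nat.find_spec hex, fun h' hlt => not_le.1 (Nat.find_min hex hlt)⟩
  obtain ⟨I, hgI, hIg, hI⟩ : ∃ I, good h ⊆ I ∧ I ⊆ good (h - 1) ∧ #I = h := by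
    have hsub : good h ⊆ good (h - 1) := fun i hi => by
      simp only [good, mem_filter, mem_univ, true_and] at hi ⊢
      obtain ⟨e, he, hev, hec⟩ := hi
      exact ⟨e, he, fun v hv => (Nat.sub_le h 1).trans (hev v hv), hec⟩
    rcases Nat.eq_zero_or_pos h with rfl | hpos
    · exact ⟨good 0, Subset.rfl, hsub, by omega⟩
    · exact exists_subsuperset_card_eq hsub hh (by have := hmin (h - 1) (by omega); omega)
  have hhk : h ≤ k := by rw [← hI]; exact (card_le_univ _).trans (by simp)
  obtain ⟨q, hq⟩ : ∃ q, h + q = k := ⟨k - h, by omega⟩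
  by_contra! hcon
  refine hno (hasRainbowMatching_of_heavy_light hr hcl hG hq I hI (fun i hi => ?_) fun i hi => ?_)
  · simpa [good] using hIg hi
  · have hq1 : 1 ≤ q := by
      have : #I < #(univ : Finset (Fin k)) :=
        card_lt_card ((ssubset_univ_iff).2 fun hu => hi (hu ▸ mem_univ i))
      rw [card_univ, Fintype.card_fin] at this
      omega
    refine hcon i h q hq hq1 fun e he hev => ?_
    by_contra! hlt
    refine hi (hgI ?_)
    simp only [good, mem_filter, mem_univ, true_and]
    exact ⟨e, he, hev, by omega⟩

theorem exists_initial_subset (S : Finset ℕ) (m : ℕ) (hm : m ≤ #S) :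
    ∃ X ⊆ S, #X = m ∧ ∀ x ∈ X, ∀ y ∈ S \ X, x < y := by
  induction m with
  | zero => exact ⟨∅, empty_subset _, card_empty, by simp⟩
  | succ m ih =>
    obtain ⟨X, hXS, hX, hlt⟩ := ih (by omega)
    have hne : (S \ X).Nonempty := by
      rw [← card_pos, card_sdiff_of_subset hXS]; omega
    obtain ⟨z, hz, hmin⟩ := exists_min_image (S \ X) id hne
    have hz' := mem_sdiff.1 hz
    refine ⟨insert z X, insert_subset hz'.1 hXS, by rw [card_insert_of_notMem hz'.2, hX], ?_⟩
    intro x hx y hy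
    rw [mem_sdiff, mem_insert, not_or] at hy
    have hyX : y ∈ S \ X := mem_sdiff.2 ⟨hy.1, hy.2.2⟩
    rcases mem_insert.1 hx with rfl | hx
    · exact lt_of_le_of_ne (hmin y hyX) (Ne.symm hy.2.1)
    · exact hlt x hx y hyX

/-- The `s`-subsets of `range n` with at least `b` elements below `p`. -/
def setsMeeting (n s b p : ℕ) : Finset (Finset ℕ) :=
  ((range n).powersetCard s).filter fun S => b ≤ #(S.filter (· < p))

theorem cliquesBelow_sdiff_subset {n h q m r : ℕ} {H : Finset (Finset ℕ)}
    (hB : ∀ e ∈ H, ∃ a, 1 ≤ a ∧ a ≤ r ∧ a ≤ #(e.filter (· < h + a * q - 1))) :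
    cliquesBelow n r (m + r) H \ setsMeeting n (m + r) (m + 1) (h + q - 1) ⊆
      (Icc 2 r).biUnion fun a =>
        ((range (h + a * q - 1 - a)).powersetCard m ×ˢ
          (Ico (h + q - 1) (h + a * q - 1)).powersetCard a ×ˢ
          (range n).powersetCard (r - a)).image fun p => p.1 ∪ (p.2.1 ∪ p.2.2) := by
  intro S hS
  simp only [mem_sdiff, cliquesBelow, setsMeeting, mem_filter, mem_powersetCard, not_and,
    not_le] at hS
  obtain ⟨⟨⟨hSn, hSc⟩, hcl⟩, hfew⟩ := hS
  have hfew := hfew ⟨hSn, hSc⟩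
  obtain ⟨X, hXS, hX, hlt⟩ := exists_initial_subset S m (by omega)
  have hU : #(S \ X) = r := by rw [card_sdiff_of_subset hXS]; omega
  have hUge : ∀ y ∈ S \ X, h + q - 1 ≤ y := by
    intro y hy
    by_contra! hyk
    have hsub : insert y X ⊆ S.filter (· < h + q - 1) := by
      intro v hv
      rcases mem_insert.1 hv with rfl | hv
      · exact mem_filter.2 ⟨(mem_sdiff.1 hy).1, hyk⟩
      · exact mem_filter.2 ⟨hXS hv, (hlt v hv y hy).trans hyk⟩
    have := card_le_card hsub
    rw [card_insert_of_notMem (mem_sdiff.1 hy).2] at this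
    omega
  obtain ⟨a, ha1, har, ha⟩ := hB _ (hcl (mem_powersetCard.2 ⟨sdiff_subset, hU⟩))
  obtain ⟨Y, hYU, hY⟩ := exists_subset_card_eq ha
  have hYIco : Y ⊆ Ico (h + q - 1) (h + a * q - 1) := fun y hy => by
    have := mem_filter.1 (hYU hy)
    exact mem_Ico.2 ⟨hUge y this.1, this.2⟩
  have hYS : Y ⊆ S \ X := hYU.trans (filter_subset _ _)
  have ha2 : 2 ≤ a := by
    by_contra! hlt2
    obtain rfl : a = 1 := by omega
    rw [one_mul, Ico_self, subset_empty] at hYIco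
    simp [hYIco] at hY
  refine mem_biUnion.2 ⟨a, mem_Icc.2 ⟨ha2, har⟩, mem_image.2 ⟨(X, Y, (S \ X) \ Y), ?_, ?_⟩⟩
  · simp only [mem_product, mem_powersetCard]
    refine ⟨⟨fun x hx => ?_, hX⟩, ⟨hYIco, hY⟩,
      (sdiff_subset.trans sdiff_subset).trans hSn, by rw [card_sdiff_of_subset hYS, hU, hY]⟩
    have hsub : Y ⊆ Ioo x (h + a * q - 1) := fun y hy =>
      mem_Ioo.2 ⟨hlt x hx y (hYS hy), (mem_Ico.1 (hYIco hy)).2⟩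
    have := card_le_card hsub
    rw [hY, Nat.card_Ioo] at this
    rw [mem_range]
    omega
  · dsimp only
    rw [union_sdiff_of_subset hYS, union_sdiff_of_subset hXS]

theorem card_cliquesBelow_sdiff_le {n h q m r : ℕ} {H : Finset (Finset ℕ)}
    (hB : ∀ e ∈ H, ∃ a, 1 ≤ a ∧ a ≤ r ∧ a ≤ #(e.filter (· < h + a * q - 1))) :
    #(cliquesBelow n r (m + r) H \ setsMeeting n (m + r) (m + 1) (h + q - 1)) ≤
      ∑ a ∈ Icc 2 r,
        (h + a * q - 1 - a).choose m * ((a - 1) * q).choose a * n.choose (r - a) := by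
  refine (card_le_card (cliquesBelow_sdiff_subset hB)).trans (card_biUnion_le.trans ?_)
  refine sum_le_sum fun a ha => card_image_le.trans ?_
  simp only [card_product, card_powersetCard, card_range, Nat.card_Ico]
  rw [mul_assoc]
  gcongr
  rw [tsub_mul, one_mul]
  omega

theorem le_card_setsMeeting_sdiff {n k h m r : ℕ} (hr : 1 ≤ r) (hk : k ≤ n) (hk1 : 1 ≤ k)
    (hh : h ≤ k - 1) {H : Finset (Finset ℕ)}
    (hA : ∀ e ∈ H, (∀ v ∈ e, h ≤ v) → 2 ≤ #(e.filter (· < r * k))) :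
    ((k - 1).choose (m + 1) - h.choose (m + 1)) * (n - r * k).choose (r - 1) ≤
      #(setsMeeting n (m + r) (m + 1) (k - 1) \ cliquesBelow n r (m + r) H) := by
  have hkr : k ≤ r * k := Nat.le_mul_of_pos_left k hr
  have hsub : (range h).powersetCard (m + 1) ⊆ (range (k - 1)).powersetCard (m + 1) :=
    powersetCard_mono (range_subset_range.2 hh)
  let P := ((range (k - 1)).powersetCard (m + 1) \ (range h).powersetCard (m + 1)) ×ˢ
    (Ico (r * k) n).powersetCard (r - 1)
  have hP : #P = ((k - 1).choose (m + 1) - h.choose (m + 1)) * (n - r * k).choose (r - 1) := by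
    simp only [P, card_product, card_sdiff_of_subset hsub, card_powersetCard, card_range,
      Nat.card_Ico]
  have hmem : ∀ p ∈ P, (p.1 ⊆ range (k - 1) ∧ #p.1 = m + 1 ∧ ¬ p.1 ⊆ range h) ∧
      p.2 ⊆ Ico (r * k) n ∧ #p.2 = r - 1 := by
    intro p hp
    simp only [P, mem_product, mem_sdiff, mem_powersetCard] at hp
    tauto
  have hfilter : ∀ p ∈ P, (p.1 ∪ p.2).filter (· < k - 1) = p.1 := by
    intro p hp
    obtain ⟨⟨h1, -, -⟩, h2, -⟩ := hmem p hp
    rw [filter_union, filter_true_of_mem fun v hv => mem_range.1 (h1 hv),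
      filter_false_of_mem, union_empty]
    intro v hv
    have := (mem_Ico.1 (h2 hv)).1
    omega
  have hdisj : ∀ p ∈ P, Disjoint p.1 p.2 := by
    intro p hp
    obtain ⟨⟨h1, -, -⟩, h2, -⟩ := hmem p hp
    rw [disjoint_left]
    intro v hv hv'
    have := mem_range.1 (h1 hv)
    have := (mem_Ico.1 (h2 hv')).1
    omega
  have hinj : Set.InjOn (fun p : Finset ℕ × Finset ℕ => p.1 ∪ p.2) P := by
    intro p hp p' hp' heq
    dsimp only at heq
    rw [mem_coe] at hp hp'
    have h1 : p.1 = p'.1 := by rw [← hfilter p hp, heq, hfilter p' hp']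
    refine Prod.ext h1 ?_
    rw [← union_sdiff_cancel_left (hdisj p hp), heq, h1, union_sdiff_cancel_left (hdisj p' hp')]
  rw [← hP, ← card_image_of_injOn hinj]
  refine card_le_card fun S hS => ?_
  obtain ⟨p, hp, rfl⟩ := mem_image.1 hS
  obtain ⟨⟨h1, h1c, h1h⟩, h2, h2c⟩ := hmem p hp
  simp only [mem_sdiff, setsMeeting, cliquesBelow, mem_filter, mem_powersetCard]
  refine ⟨⟨⟨union_subset (h1.trans (range_subset_range.2 (by omega))) fun v hv =>
    mem_range.2 (mem_Ico.1 (h2 hv)).2, ?_⟩, ?_⟩, fun hcon => ?_⟩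
  · rw [card_union_of_disjoint (hdisj p hp), h1c, h2c]; omega
  · rw [hfilter p hp, h1c]
  · obtain ⟨x, hx, hxh⟩ := not_subset.1 h1h
    rw [mem_range, not_lt] at hxh
    have hxk := mem_range.1 (h1 hx)
    have hxZ : x ∉ p.2 := disjoint_left.1 (hdisj p hp) hx
    have hE : insert x p.2 ∈ H := by
      refine hcon.2 (mem_powersetCard.2 ⟨insert_subset (mem_union_left _ hx)
        subset_union_right, ?_⟩)
      rw [card_insert_of_notMem hxZ, h2c]; omega
    have htwo := hA _ hE fun v hv => by
      rcases mem_insert.1 hv with rfl | hv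
      · exact hxh
      · have := (mem_Ico.1 (h2 hv)).1
        omega
    have hone : (insert x p.2).filter (· < r * k) ⊆ {x} := fun v hv => by
      rw [mem_filter, mem_insert] at hv
      rcases hv.1 with rfl | hv'
      · exact mem_singleton_self _
      · have := (mem_Ico.1 (h2 hv')).1
        omega
    have := card_le_card hone
    rw [card_singleton] at this
    omega

/-- A restricted family has at most as many cliques as the extremal hypergraph. -/
theorem card_cliquesBelow_le_setsMeeting {n k h q m r : ℕ} (hr : 1 ≤ r) (hq : 1 ≤ q)
    (hk : h + q = k) (hm : m + 2 ≤ k) (hkn : k ≤ n)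
    (hn : 4 * (k : ℝ) * ((m : ℝ) + 2) * (Real.exp 1 * r) ^ (m + 2) ≤ n)
    {H : Finset (Finset ℕ)}
    (hA : ∀ e ∈ H, (∀ v ∈ e, h ≤ v) → 2 ≤ #(e.filter (· < r * k)))
    (hB : ∀ e ∈ H, ∃ a, 1 ≤ a ∧ a ≤ r ∧ a ≤ #(e.filter (· < h + a * q - 1))) :
    #(cliquesBelow n r (m + r) H) ≤ #(setsMeeting n (m + r) (m + 1) (k - 1)) := by
  have h1 := card_cliquesBelow_sdiff_le (n := n) (m := m) hB
  have h2 := le_card_setsMeeting_sdiff (m := m) hr hkn (by omega) (by omega : h ≤ k - 1) hA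
  subst hk
  exact card_sdiff_le_card_sdiff_iff.1
    ((h1.trans (sum_choose_mul_le n h q m r hr hq hm hn)).trans h2)

theorem card_setsMeeting_le_cliqueCount_Fnka {n k r m : ℕ} :
    #(setsMeeting n (m + r) (m + 1) k) ≤ cliqueCount r (m + r) (Fnka n k r 1) := by
  rw [cliqueCount, ← card_map (mapEmbedding Fin.valEmbedding).toEmbedding]
  refine card_le_card fun S hS => ?_
  rw [setsMeeting, mem_filter, mem_powersetCard] at hS
  obtain ⟨⟨hSn, hSc⟩, hSk⟩ := hS
  obtain ⟨T, rfl⟩ : ∃ T : Finset (Fin n), T.map Fin.valEmbedding = S := by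
    refine ⟨S.attachFin fun v hv => mem_range.1 (hSn hv), ?_⟩
    ext v; simp
  refine mem_map.2 ⟨T, ?_, rfl⟩
  rw [card_map] at hSc
  rw [filter_map, card_map] at hSk
  refine mem_filter.2 ⟨mem_powersetCard.2 ⟨subset_univ _, hSc⟩, fun E hE => ?_⟩
  rw [mem_powersetCard] at hE
  refine mem_filter.2 ⟨mem_powersetCard.2 ⟨subset_univ _, hE.2⟩, ?_⟩
  rw [one_mul, Nat.add_sub_cancel]
  by_contra! hlt
  have hE0 : ∀ x ∈ E, ¬ (x : ℕ) < k := filter_eq_empty_iff.1 (card_eq_zero.1 (by omega))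
  have hsub : E ⊆ T.filter fun x => ¬ (x : ℕ) < k := fun x hx =>
    mem_filter.2 ⟨hE.1 hx, hE0 x hx⟩
  have h1 := card_le_card hsub
  have h2 := card_filter_add_card_filter_not (s := T) fun x : Fin n => (x : ℕ) < k
  have h3 : #(T.filter fun x : Fin n => (x : ℕ) < k) =
    #(T.filter ((fun x => x < k) ∘ ⇑Fin.valEmbedding)) := rfl
  omega

theorem cliqueCount_le_card_cliquesBelow {V : Type*} [Fintype V] [DecidableEq V] {n : ℕ}
    (r s : ℕ) (φ : V ↪ ℕ) (hφ : ∀ v, φ v < n) (H : Finset (Finset V)) :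
    cliqueCount r s H ≤ #(cliquesBelow n r s (H.map (mapEmbedding φ).toEmbedding)) := by
  rw [cliqueCount, ← card_map (mapEmbedding φ).toEmbedding]
  refine card_le_card fun S hS => ?_
  obtain ⟨T, hT, rfl⟩ := mem_map.1 hS
  rw [mem_filter, mem_powersetCard] at hT
  refine mem_filter.2 ⟨mem_powersetCard.2 ⟨fun x hx => ?_, ?_⟩, ?_⟩
  · obtain ⟨v, -, rfl⟩ := mem_map.1 hx
    exact mem_range.2 (hφ v)
  · exact (card_map φ).trans hT.1.2
  · rw [RelEmbedding.coe_toEmbedding, mapEmbedding_apply, powersetCard_map]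
    exact map_subset_map.2 hT.2

theorem HasRainbowMatching.of_map {ι α β : Type*} (φ : α ↪ β) {F : ι → Finset (Finset α)}
    (h : HasRainbowMatching fun x => (F x).map (mapEmbedding φ).toEmbedding) :
    HasRainbowMatching F := by
  obtain ⟨e, he, hdis⟩ := h
  choose e' he' hee using fun x => mem_map.1 (he x)
  refine ⟨e', he', fun x y hxy => ?_⟩
  have := hdis x y hxy
  rw [← hee x, ← hee y] at this
  exact (disjoint_map φ).1 this

theorem hasRainbowMatching_of_card_lt {n k r t : ℕ} (hr : 1 ≤ r) (htk : t + 2 ≤ k + r)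
    (hn : ∀ m, m + r ≤ t →
      4 * (k : ℝ) * ((m : ℝ) + 2) * (Real.exp 1 * r) ^ (m + 2) ≤ n) (hkn : k ≤ n)
    (F : Fin k → Finset (Finset ℕ)) (hF : ∀ i, ∀ E ∈ F i, #E = r)
    (hcl : ∀ i, ∃ m, m + r ≤ t ∧
      #(setsMeeting n (m + r) (m + 1) (k - 1)) < #(cliquesBelow n r (m + r) (F i))) :
    HasRainbowMatching F := by
  obtain ⟨G, hG, hGr, hGc, hGm⟩ := exists_isLeftClosed n r F hF
  refine hGm ?_
  by_contra hno
  obtain ⟨i, h, q, hk, hq, hA, hB⟩ := exists_restricted_family hr hG hGr hno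
  obtain ⟨m, hm, hlt⟩ := hcl i
  exact absurd (hlt.trans_le (hGc i (m + r))) (not_lt.2
    (card_cliquesBelow_le_setsMeeting hr hq hk (by omega) hkn (hn m hm) hA hB))

/-- Theorem 1.6 (rainbow matchings from many cliques). -/
theorem rainbow_matching_of_cliques {V : Type*} [Fintype V] [DecidableEq V] {n k r t : ℕ}
    (hn0 : 0 < n) (hk0 : 0 < k) (hr0 : 0 < r) (ht0 : 0 < t)
    (hrt : r ≤ t) (htk : t ≤ k + r - 2)
    (hcard : Fintype.card V = n)
    (hn : 4 * k * (t - r + 2) * (Real.exp 1 * r) ^ (t - r + 2) ≤ (n : ℝ))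
    (F : Fin k → Finset (Finset V))
    (hunif : ∀ i, ∀ E ∈ F i, E.card = r)
    (hcl : ∀ i, ∃ s, r ≤ s ∧ s ≤ t ∧
      cliqueCount r s (Fnka n (k - 1) r 1) < cliqueCount r s (F i)) :
    ∃ e : Fin k → Finset V, (∀ i, e i ∈ F i) ∧
      ∀ i j, i ≠ j → Disjoint (e i) (e j) := by
  have he : (1 : ℝ) ≤ Real.exp 1 := Real.one_le_exp zero_le_one
  have hrR : (1 : ℝ) ≤ r := by exact_mod_cast hr0
  have her : (1 : ℝ) ≤ Real.exp 1 * r := one_le_mul_of_one_le_of_one_le he hrR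
  have hbound : ∀ m, m + r ≤ t →
      4 * (k : ℝ) * ((m : ℝ) + 2) * (Real.exp 1 * r) ^ (m + 2) ≤ n := by
    intro m hm
    have hmR : (m : ℝ) + r ≤ t := by exact_mod_cast hm
    refine le_trans ?_ hn
    have h1 : (Real.exp 1 * r) ^ (m + 2) ≤ (Real.exp 1 * r) ^ (t - r + 2) :=
      pow_le_pow_right₀ her (by omega)
    have h2 : (m : ℝ) + 2 ≤ t - r + 2 := by linarith
    have h3 : (0 : ℝ) ≤ t - r + 2 := by linarith [Nat.cast_nonneg (α := ℝ) m]
    gcongr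
  have hkn : k ≤ n := by
    have h1 := hbound 0 (by omega)
    have h2 : (1 : ℝ) ≤ (Real.exp 1 * r) ^ 2 := one_le_pow₀ her
    have h3 : (0 : ℝ) ≤ k := Nat.cast_nonneg k
    have : (k : ℝ) ≤ n := by
      have h4 : (k : ℝ) ≤ k * (Real.exp 1 * r) ^ 2 := le_mul_of_one_le_right h3 h2
      push_cast at h1
      linarith
    exact_mod_cast this
  let φ : V ↪ ℕ := (Fintype.equivFinOfCardEq hcard).toEmbedding.trans Fin.valEmbedding
  have hφ : ∀ v, φ v < n := fun v => (Fintype.equivFinOfCardEq hcard v).isLt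
  refine HasRainbowMatching.of_map φ
    (hasRainbowMatching_of_card_lt hr0 (t := t) (by omega) hbound hkn _ ?_ fun i => ?_)
  · intro i E hE
    obtain ⟨E', hE', rfl⟩ := mem_map.1 hE
    exact (card_map φ).trans (hunif i E' hE')
  · obtain ⟨s, hrs, hst, hlt⟩ := hcl i
    obtain ⟨m, rfl⟩ : ∃ m, s = m + r := ⟨s - r, by omega⟩
    exact ⟨m, hst, (card_setsMeeting_le_cliqueCount_Fnka.trans_lt hlt).trans_le
      (cliqueCount_le_card_cliquesBelow r (m + r) φ hφ (F i))⟩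
end
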